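/- arXiv:1411.4950 — 10 statements merged into one kernel-verified Lean document; each statement's English description precedes it below -/
import Mathlib

section
/- There is a constant C, depending only on M, with the following property: if |t| ≤ 1 and (x, ξ), (x̃, ξ̃) are Hamiltonian trajectories with the same initial momentum ξ(0) = ξ̃(0) = η and initial positions x(0) = y, x̃(0) = ỹ, then ‖x(t) − x̃(t) − (y − ỹ)‖ ≤ C t² ‖y − ỹ‖. (This expresses the derivative estimate ∂x/∂y = I + t² a(t,y,η) with a uniformly bounded.) -/
open ContDiff

/-- A Hamiltonian trajectory for `H(ξ,x) = |ξ|²/2 + V(x)`: a pair of curves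
`x, ξ : ℝ → ℝ^d` satisfying Hamilton's equations `x' = ξ` and `ξ' = -∇V(x)`. -/
def IsHamTraj {d : ℕ} (V : EuclideanSpace ℝ (Fin d) → ℝ)
    (x ξ : ℝ → EuclideanSpace ℝ (Fin d)) : Prop :=
  (∀ t : ℝ, HasDerivAt x (ξ t) t) ∧
    (∀ t : ℝ, HasDerivAt ξ (-(gradient V (x t))) t)

theorem aux_fwd {E : Type*} [NormedAddCommGroup E] [NormedSpace ℝ E] (M : ℝ) (hM : 0 < M)
    (u v w : ℝ → E) (hu : ∀ t, HasDerivAt u (v t) t) (hv : ∀ t, HasDerivAt v (w t) t)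
    (hw : ∀ t, ‖w t‖ ≤ M * ‖u t‖) (v0 : v 0 = 0) (t : ℝ) (h0 : 0 ≤ t) (h1 : t ≤ 1) :
    ‖u t - u 0‖ ≤ M * Real.exp (1 + M) * t ^ 2 * ‖u 0‖ := by
  have hB : ∀ s ∈ Set.Icc (0:ℝ) 1, ‖u s‖ ≤ ‖u 0‖ * Real.exp (1 + M) := by
    intro s hs
    have hd : ∀ r, HasDerivAt (fun r => (u r, v r)) (v r, w r) r := fun r => (hu r).prodMk (hv r)
    have := norm_le_gronwallBound_of_norm_deriv_right_le (f := fun r => (u r, v r))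
      (f' := fun r => (v r, w r)) (δ := ‖u 0‖) (K := 1 + M) (ε := 0) (a := 0) (b := 1)
      (fun r _ => (hd r).continuousAt.continuousWithinAt)
      (fun r _ => (hd r).hasDerivWithinAt)
      (by simp [v0, Prod.norm_def])
      (by
        intro r _
        have a1 : ‖u r‖ ≤ ‖(u r, v r)‖ := norm_fst_le (u r, v r)
        have a2 : ‖v r‖ ≤ ‖(u r, v r)‖ := norm_snd_le (u r, v r)
        have a3 := norm_nonneg (u r, v r)
        have a4 := hw r
        have a5 := mul_le_mul_of_nonneg_left a1 hM.le
        rw [Prod.norm_def (v r, w r)]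
        apply max_le <;> simp only <;> nlinarith) s hs
    rw [gronwallBound_ε0] at this
    have a1 : ‖u s‖ ≤ ‖(u s, v s)‖ := norm_fst_le (u s, v s)
    refine a1.trans (this.trans ?_)
    gcongr
    have := hs.2
    nlinarith
  set B := M * (‖u 0‖ * Real.exp (1 + M)) with hBdef
  have hB0 : 0 ≤ B := by positivity
  have hvB : ∀ s ∈ Set.Icc (0:ℝ) 1, ‖v s‖ ≤ B * s := by
    intro s hs
    have := norm_image_sub_le_of_norm_deriv_le_segment' (f := v) (f' := w) (C := B) (a := 0)
      (b := 1) (fun r _ => (hv r).hasDerivWithinAt)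
      (fun r hr => (hw r).trans (mul_le_mul_of_nonneg_left (hB r ⟨hr.1, hr.2.le⟩) hM.le)) s hs
    simpa [v0] using this
  have := norm_image_sub_le_of_norm_deriv_le_segment' (f := u) (f' := v) (C := B * t) (a := 0)
      (b := t) (fun r _ => (hu r).hasDerivWithinAt)
      (fun r hr => (hvB r ⟨hr.1, hr.2.le.trans h1⟩).trans
        (mul_le_mul_of_nonneg_left hr.2.le hB0)) t ⟨h0, le_rfl⟩
  refine this.trans (le_of_eq ?_)
  rw [hBdef]; ring

theorem aux_grad {d : ℕ} (M : ℝ) (V : EuclideanSpace ℝ (Fin d) → ℝ) (hV : ContDiff ℝ ∞ V)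
    (h : ∀ z, ‖iteratedFDeriv ℝ 2 V z‖ ≤ M) (a b : EuclideanSpace ℝ (Fin d)) :
    ‖gradient V a - gradient V b‖ ≤ M * ‖a - b‖ := by
  have e : gradient V a - gradient V b =
      (InnerProductSpace.toDual ℝ _).symm (fderiv ℝ V a - fderiv ℝ V b) := by
    simp [gradient]
  rw [e, LinearIsometryEquiv.norm_map]
  have hd : Differentiable ℝ (fderiv ℝ V) :=
    (hV.fderiv_right (m := 1) (by norm_cast)).differentiable (by simp)
  refine Convex.norm_image_sub_le_of_norm_fderiv_le (𝕜 := ℝ) (s := Set.univ)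
    (fun z _ => hd z) (fun z _ => ?_) convex_univ (Set.mem_univ _) (Set.mem_univ _)
  have := h z
  rwa [← norm_iteratedFDeriv_fderiv, norm_iteratedFDeriv_one] at this

theorem stmt3 (M : ℝ) (hM : 0 < M) :
    ∃ C > 0, ∀ (d : ℕ), 1 ≤ d →
      ∀ V : EuclideanSpace ℝ (Fin d) → ℝ, ContDiff ℝ ∞ V →
      (∀ z, ‖iteratedFDeriv ℝ 2 V z‖ ≤ M) →
      ∀ t : ℝ, |t| ≤ 1 →
      ∀ x ξ x' ξ' : ℝ → EuclideanSpace ℝ (Fin d),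
        IsHamTraj V x ξ → IsHamTraj V x' ξ' →
        ∀ y y' η : EuclideanSpace ℝ (Fin d),
          x 0 = y → x' 0 = y' → ξ 0 = η → ξ' 0 = η →
          ‖x t - x' t - (y - y')‖ ≤ C * t ^ 2 * ‖y - y'‖ := by
  refine ⟨M * Real.exp (1 + M), by positivity, ?_⟩
  intro d _ V hV hH t ht x ξ x' ξ' h h' y y' η hy hy' hη hη'
  subst hy hy'
  have hw : ∀ s, ‖-(gradient V (x s)) - -(gradient V (x' s))‖ ≤ M * ‖x s - x' s‖ := by
    intro s
    have := aux_grad M V hV hH (x s) (x' s)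
    rwa [neg_sub_neg, norm_sub_rev]
  have hu : ∀ s, HasDerivAt (fun s => x s - x' s) (ξ s - ξ' s) s :=
    fun s => (h.1 s).sub (h'.1 s)
  have hv : ∀ s, HasDerivAt (fun s => ξ s - ξ' s)
      (-(gradient V (x s)) - -(gradient V (x' s))) s :=
    fun s => (h.2 s).sub (h'.2 s)
  rcases le_total 0 t with h0 | h0
  · exact aux_fwd M hM _ _ _ hu hv hw (by simp [hη, hη']) t h0 (abs_le.1 ht).2
  · have hneg : ∀ s : ℝ, HasDerivAt (fun s : ℝ => -s) (-1) s := fun s => hasDerivAt_neg s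
    have := aux_fwd M hM (fun s => x (-s) - x' (-s)) (fun s => -(ξ (-s) - ξ' (-s)))
      (fun s => -(gradient V (x (-s))) - -(gradient V (x' (-s))))
      (fun s => ((hu (-s)).scomp s (hneg s)).congr_deriv (neg_one_smul ℝ _))
      (fun s => ((hv (-s)).scomp s (hneg s)).neg.congr_deriv (by rw [neg_one_smul, neg_neg]))
      (fun s => hw (-s)) (by simp [hη, hη']) (-t) (by linarith) (by linarith [(abs_le.1 ht).1])
    simpa using this
end

section
/- There is a constant C, depending only on M, with the following property: if |t| ≤ 1 and (x, ξ), (x̃, ξ̃) are Hamiltonian trajectories with the same initial position x(0) = x̃(0) = y and initial momenta ξ(0) = η, ξ̃(0) = η̃, then ‖x(t) − x̃(t) − t(η − η̃)‖ ≤ C |t|³ ‖η − η̃‖. (This expresses the derivative estimate ∂x/∂η = t(I + t² b(t,y,η)) with b uniformly bounded.) -/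
open ContDiff

theorem core_est {E : Type*} [NormedAddCommGroup E] [NormedSpace ℝ E] {M : ℝ} (hM : 0 < M)
    (u p q : ℝ → E) (hu : ∀ t, HasDerivAt u (p t) t) (hp : ∀ t, HasDerivAt p (q t) t)
    (hq : ∀ t, ‖q t‖ ≤ M * ‖u t‖) (h0 : u 0 = 0) (t : ℝ) (ht0 : 0 ≤ t) (ht1 : t ≤ 1) :
    ‖u t - t • p 0‖ ≤ (M * Real.exp (1 + M)) * t ^ 3 * ‖p 0‖ := by
  set A := ‖p 0‖ * Real.exp (1 + M) with hA
  have hA0 : 0 ≤ A := by positivity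
  have hup : ∀ s, HasDerivAt (fun s => (u s, p s)) (p s, q s) s := fun s => (hu s).prodMk (hp s)
  have key : ∀ s ∈ Set.Icc (0:ℝ) 1, ‖p s‖ ≤ A := by
    intro s hs
    have h := norm_le_gronwallBound_of_norm_deriv_right_le (f := fun s => (u s, p s))
      (f' := fun s => (p s, q s)) (δ := ‖p 0‖) (K := 1 + M) (ε := 0) (a := 0) (b := 1)
      (fun s _ => (hup s).continuousAt.continuousWithinAt)
      (fun s _ => (hup s).hasDerivWithinAt) (by simp [Prod.norm_def, h0]) (by
        intro s _
        have h1 := norm_fst_le (u s, p s)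
        have h2 := norm_snd_le (u s, p s)
        have h3 := hq s
        simp only at h1 h2 ⊢
        have h4 : ‖(p s, q s)‖ = max ‖p s‖ ‖q s‖ := rfl
        have h5 := norm_nonneg (u s, p s)
        rw [h4, add_zero]
        apply max_le <;> nlinarith) s hs
    rw [gronwallBound_ε0, sub_zero] at h
    refine (norm_snd_le (u s, p s)).trans (h.trans ?_)
    rw [hA]
    gcongr
    nlinarith [hs.2]
  have hus : ∀ s ∈ Set.Icc (0:ℝ) 1, ‖u s‖ ≤ A * s := by
    intro s hs
    refine image_norm_le_of_norm_deriv_right_le_deriv_boundary (a := 0) (b := 1) (f' := p)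
      (B := fun s => A * s) (B' := fun _ => A)
      (fun s _ => (hu s).continuousAt.continuousWithinAt)
      (fun s _ => (hu s).hasDerivWithinAt) (by simp [h0])
      (fun s => by simpa using (hasDerivAt_id s).const_mul A)
      (fun s hs => key s ⟨hs.1, hs.2.le⟩) hs
  have hps : ∀ s ∈ Set.Icc (0:ℝ) 1, ‖p s - p 0‖ ≤ M * A * s ^ 2 := by
    intro s hs
    refine image_norm_le_of_norm_deriv_right_le_deriv_boundary (a := 0) (b := 1)
      (f := fun s => p s - p 0) (f' := q)
      (B := fun s => M * A * s ^ 2) (B' := fun s => M * A * (2 * s))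
      (fun s _ => ((hp s).sub_const _).continuousAt.continuousWithinAt)
      (fun s _ => ((hp s).sub_const _).hasDerivWithinAt) (by simp)
      (fun s => by simpa using (hasDerivAt_pow 2 s).const_mul (M * A))
      (fun s hs => ?_) hs
    have h1 := hus s ⟨hs.1, hs.2.le⟩
    have h2 : 0 ≤ M * A * s := mul_nonneg (by positivity) hs.1
    have h3 := mul_le_mul_of_nonneg_left h1 hM.le
    linarith [hq s]
  have hd : ∀ s, HasDerivAt (fun s => u s - s • p 0) (p s - p 0) s := fun s => by
    have h1 := (hu s).sub ((hasDerivAt_id s).smul_const (p 0))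
    rw [one_smul] at h1
    exact h1
  have fin : ‖u t - t • p 0‖ ≤ M * A * t ^ 3 := by
    refine image_norm_le_of_norm_deriv_right_le_deriv_boundary (a := 0) (b := 1)
      (f := fun s => u s - s • p 0) (f' := fun s => p s - p 0)
      (B := fun s => M * A * s ^ 3) (B' := fun s => M * A * (3 * s ^ 2))
      (fun s _ => (hd s).continuousAt.continuousWithinAt)
      (fun s _ => (hd s).hasDerivWithinAt) (by simp [h0])
      (fun s => by simpa using (hasDerivAt_pow 3 s).const_mul (M * A))
      (fun s hs => ?_) ⟨ht0, ht1⟩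
    have h1 := hps s ⟨hs.1, hs.2.le⟩
    have h2 : 0 ≤ M * A * s ^ 2 := by positivity
    linarith
  rw [hA] at fin
  linarith

theorem grad_lip {d : ℕ} {M : ℝ} (V : EuclideanSpace ℝ (Fin d) → ℝ) (hV : ContDiff ℝ ∞ V)
    (hb : ∀ z, ‖iteratedFDeriv ℝ 2 V z‖ ≤ M) (a b : EuclideanSpace ℝ (Fin d)) :
    ‖gradient V a - gradient V b‖ ≤ M * ‖a - b‖ := by
  unfold gradient
  rw [← map_sub, LinearIsometryEquiv.norm_map]
  have hd : Differentiable ℝ (fderiv ℝ V) :=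
    (hV.fderiv_right (m := 1) (by norm_cast)).differentiable (by norm_num)
  refine Convex.norm_image_sub_le_of_norm_fderiv_le (𝕜 := ℝ) (s := Set.univ)
    (fun z _ => hd z) (fun z _ => ?_) convex_univ (Set.mem_univ _) (Set.mem_univ _)
  have := hb z
  rwa [← norm_iteratedFDeriv_fderiv, norm_iteratedFDeriv_one] at this

theorem stmt4 (M : ℝ) (hM : 0 < M) :
    ∃ C > 0, ∀ (d : ℕ), 1 ≤ d →
      ∀ V : EuclideanSpace ℝ (Fin d) → ℝ, ContDiff ℝ ∞ V →
      (∀ z, ‖iteratedFDeriv ℝ 2 V z‖ ≤ M) →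
      ∀ t : ℝ, |t| ≤ 1 →
      ∀ x ξ x' ξ' : ℝ → EuclideanSpace ℝ (Fin d),
        IsHamTraj V x ξ → IsHamTraj V x' ξ' →
        ∀ y η η' : EuclideanSpace ℝ (Fin d),
          x 0 = y → x' 0 = y → ξ 0 = η → ξ' 0 = η' →
          ‖x t - x' t - t • (η - η')‖ ≤ C * |t| ^ 3 * ‖η - η'‖ := by
  refine ⟨M * Real.exp (1 + M), by positivity, ?_⟩
  intro d _ V hV hb t ht x ξ x' ξ' h h' y η η' hx hx' hξ hξ'
  have hq : ∀ s, ‖-(gradient V (x s)) - -(gradient V (x' s))‖ ≤ M * ‖x s - x' s‖ := fun s => by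
    rw [neg_sub_neg, norm_sub_rev]
    exact grad_lip V hV hb _ _
  have hu : ∀ s, HasDerivAt (fun s => x s - x' s) (ξ s - ξ' s) s :=
    fun s => (h.1 s).sub (h'.1 s)
  have hp : ∀ s, HasDerivAt (fun s => ξ s - ξ' s)
      (-(gradient V (x s)) - -(gradient V (x' s))) s :=
    fun s => (h.2 s).sub (h'.2 s)
  subst hξ hξ'
  rcases le_total 0 t with h0 | h0
  · rw [abs_of_nonneg h0] at ht ⊢
    exact core_est hM _ _ _ hu hp hq (by simp [hx, hx']) t h0 ht
  · rw [abs_of_nonpos h0] at ht ⊢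
    have hu2 : ∀ s, HasDerivAt (fun s => x (-s) - x' (-s)) (-(ξ (-s) - ξ' (-s))) s := fun s => by
      have h1 := (hu (-s)).scomp s (hasDerivAt_neg s)
      rw [neg_one_smul] at h1
      exact h1
    have hp2 : ∀ s, HasDerivAt (fun s => -(ξ (-s) - ξ' (-s)))
        (-(gradient V (x (-s))) - -(gradient V (x' (-s)))) s := fun s => by
      have h1 := ((hp (-s)).scomp s (hasDerivAt_neg s)).neg
      rw [neg_one_smul, neg_neg] at h1
      exact h1
    have := core_est hM _ _ _ hu2 hp2 (fun s => hq (-s)) (by simp [hx, hx']) (-t) (by linarith) ht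
    simp only [neg_neg, neg_zero, norm_neg, smul_neg, neg_smul] at this
    exact this
end

section
/- There exists δ₀ > 0, depending only on M, such that for every t with 0 < |t| ≤ δ₀ and every pair of points x, y ∈ ℝ^d there is a unique initial momentum η ∈ ℝ^d such that the Hamiltonian trajectory with x(0) = y and ξ(0) = η satisfies x(t) = x. That is, for small nonzero times there is a unique classical trajectory joining y at time 0 to x at time t. -/
open ContDiff

theorem ham_key {E : Type*} [NormedAddCommGroup E] [NormedSpace ℝ E] (M : ℝ) (hM : 0 < M)
    (u w a : ℝ → E) (hu : ∀ s, HasDerivAt u (w s) s) (hw : ∀ s, HasDerivAt w (a s) s)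
    (ha : ∀ s, ‖a s‖ ≤ M * ‖u s‖) (h0 : u 0 = 0) (t : ℝ) (ht : M * t ^ 2 ≤ 1 / 4) :
    ‖u t - t • w 0‖ ≤ |t| / 2 * ‖w 0‖ := by
  have hcu : Continuous u := continuous_iff_continuousAt.2 fun s => (hu s).continuousAt
  obtain ⟨s0, hs0, hmax⟩ := (isCompact_uIcc (a := (0:ℝ)) (b := t)).exists_isMaxOn
    ⟨0, Set.left_mem_uIcc⟩ hcu.norm.continuousOn
  have hm0 : 0 ≤ ‖u s0‖ := norm_nonneg _
  have habs : ∀ s ∈ Set.uIcc 0 t, |s| ≤ |t| := by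
    intro s hs
    simpa using Set.abs_sub_left_of_mem_uIcc hs
  have h1 : ∀ s ∈ Set.uIcc 0 t, ‖w s - w 0‖ ≤ M * ‖u s0‖ * |t| := by
    intro s hs
    have := Convex.norm_image_sub_le_of_norm_hasDerivWithin_le (f := w) (f' := a)
      (s := Set.uIcc 0 t) (C := M * ‖u s0‖) (x := 0) (y := s)
      (fun x _ => (hw x).hasDerivWithinAt)
      (fun x hx => (ha x).trans (mul_le_mul_of_nonneg_left (hmax hx) hM.le))
      (convex_uIcc 0 t) Set.left_mem_uIcc hs
    refine this.trans ?_
    have := habs s hs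
    rw [sub_zero, Real.norm_eq_abs]
    gcongr
  have h2 : ∀ s ∈ Set.uIcc 0 t, ‖u s - s • w 0‖ ≤ ‖u s0‖ * (M * t ^ 2) := by
    intro s hs
    have := Convex.norm_image_sub_le_of_norm_hasDerivWithin_le (f := fun s => u s - s • w 0)
      (f' := fun s => w s - w 0)
      (s := Set.uIcc 0 t) (C := M * ‖u s0‖ * |t|) (x := 0) (y := s)
      (fun x _ => by
        have := (hu x).sub ((hasDerivAt_id x).smul_const (w 0))
        rw [one_smul] at this
        exact this.hasDerivWithinAt)
      h1 (convex_uIcc 0 t) Set.left_mem_uIcc hs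
    simp only [h0, zero_smul, sub_zero, Real.norm_eq_abs] at this
    refine this.trans ?_
    have h3 := habs s hs
    calc M * ‖u s0‖ * |t| * |s| ≤ M * ‖u s0‖ * |t| * |t| := by gcongr
      _ = _ := by rw [← sq_abs t]; ring
  have h3 := h2 s0 hs0
  have h4 : ‖u s0‖ ≤ ‖u s0 - s0 • w 0‖ + ‖s0 • w 0‖ := by
    simpa using norm_add_le (u s0 - s0 • w 0) (s0 • w 0)
  have h5 : ‖s0 • w 0‖ ≤ |t| * ‖w 0‖ := by
    rw [norm_smul, Real.norm_eq_abs]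
    have := habs s0 hs0
    gcongr
  have h6 := h2 t Set.right_mem_uIcc
  have h7 : ‖u s0‖ * (M * t ^ 2) ≤ ‖u s0‖ * (1 / 4) := by gcongr
  have h8 : 0 ≤ |t| * ‖w 0‖ := by positivity
  linarith

theorem ham_global {E : Type*} [NormedAddCommGroup E] [NormedSpace ℝ E] [CompleteSpace E]
    (G : E → E) (hG : ContDiff ℝ 1 G) (K : NNReal) (hK : LipschitzWith K G) (z : E) :
    ∃ γ : ℝ → E, γ 0 = z ∧ ∀ t, HasDerivAt γ (G (γ t)) t := by
  have hε : (0 : ℝ) < 1 / (1 + K) := by positivity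
  have := exists_isMIntegralCurve_of_isMIntegralCurveOn (I := modelWithCornersSelf ℝ E) (M := E)
    (v := fun x => (G x : E))
    (by
      intro x
      exact contMDiffWithinAt_vectorSpace_iff_contDiffWithinAt.2 hG.contDiffAt)
    hε (by
      intro x
      let a : NNReal := ‖G x‖₊ + 1
      have hpl : IsPicardLindelof (fun _ : ℝ => G) (tmin := -(1 / (1 + K))) (tmax := 1 / (1 + K))
          ⟨0, by constructor <;> linarith⟩ x a 0 ((1 + K) * a) K := by
        apply IsPicardLindelof.of_time_independent
        · intro y hy
          have h1 := hK.dist_le_mul y x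
          have h2 : dist y x ≤ a := by simpa using hy
          have h3 : ‖G y‖ ≤ ‖G x‖ + ‖G y - G x‖ := by
            simpa using norm_add_le (G x) (G y - G x)
          rw [dist_eq_norm] at h1
          have h4 : (a : ℝ) = ‖G x‖ + 1 := by simp [a]
          have h5 : (K : ℝ) * dist y x ≤ K * a := by gcongr
          push_cast
          linarith
        · exact hK.lipschitzOnWith
        · simp only [sub_zero, zero_sub, neg_neg, max_self]
          push_cast
          have : (1 + (K : ℝ)) ≠ 0 := by positivity
          field_simp
          simp
      obtain ⟨α, hα0, hα⟩ := hpl.exists_eq_forall_mem_Icc_hasDerivWithinAt₀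
      refine ⟨α, hα0, fun t ht => ?_⟩
      exact ((hα t (Set.Ioo_subset_Icc_self ht)).mono
        Set.Ioo_subset_Icc_self).hasFDerivWithinAt.hasMFDerivWithinAt) z
  obtain ⟨γ, h0, h⟩ := this
  refine ⟨γ, h0, fun t => ?_⟩
  have : HasFDerivAt γ ((1 : ℝ →L[ℝ] ℝ).smulRight (G (γ t))) t := (h t).hasFDerivAt
  simpa using this.hasDerivAt

theorem ham_lip {d : ℕ} (M : ℝ) (hM : 0 < M) (V : EuclideanSpace ℝ (Fin d) → ℝ)
    (hV : ContDiff ℝ ∞ V) (hb : ∀ z, ‖iteratedFDeriv ℝ 2 V z‖ ≤ M) :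
    ContDiff ℝ 1 (fun x => gradient V x) ∧
    LipschitzWith (Real.toNNReal M) (fun x => gradient V x) := by
  have hf : ContDiff ℝ 1 (fderiv ℝ V) := hV.fderiv_right (m := 1)
    (WithTop.coe_le_coe.2 (le_top : (1 + 1 : ℕ∞) ≤ ⊤))
  constructor
  · exact (InnerProductSpace.toDual ℝ (EuclideanSpace ℝ (Fin d))).symm.contDiff.comp hf
  · have : LipschitzWith (Real.toNNReal M) (fderiv ℝ V) := by
      apply lipschitzWith_of_nnnorm_fderiv_le (𝕜 := ℝ) (hf.differentiable (by simp))
      intro x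
      rw [← NNReal.coe_le_coe, Real.coe_toNNReal _ hM.le, coe_nnnorm]
      have h1 := hb x
      have h2 := norm_iteratedFDeriv_fderiv (𝕜 := ℝ) (f := V) (x := x) (n := 1)
      have h3 := norm_iteratedFDeriv_fderiv (𝕜 := ℝ) (f := fderiv ℝ V) (x := x) (n := 0)
      rw [norm_iteratedFDeriv_zero] at h3
      rw [h3, h2]
      exact h1
    have h2 := (InnerProductSpace.toDual ℝ
      (EuclideanSpace ℝ (Fin d))).symm.isometry.lipschitz.comp this
    rw [one_mul] at h2
    exact h2

theorem ham_exists {d : ℕ} (M : ℝ) (hM : 0 < M) (V : EuclideanSpace ℝ (Fin d) → ℝ)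
    (hV : ContDiff ℝ ∞ V) (hb : ∀ z, ‖iteratedFDeriv ℝ 2 V z‖ ≤ M)
    (y η : EuclideanSpace ℝ (Fin d)) :
    ∃ X Ξ : ℝ → EuclideanSpace ℝ (Fin d), IsHamTraj V X Ξ ∧ X 0 = y ∧ Ξ 0 = η := by
  obtain ⟨hc, hl⟩ := ham_lip M hM V hV hb
  have hl2 := LipschitzWith.prod_snd (α := EuclideanSpace ℝ (Fin d))
    (β := EuclideanSpace ℝ (Fin d)) |>.prodMk ((hl.comp LipschitzWith.prod_fst).neg)
  obtain ⟨γ, h0, h⟩ := ham_global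
    (fun p : EuclideanSpace ℝ (Fin d) × EuclideanSpace ℝ (Fin d) => (p.2, -(gradient V p.1)))
    (contDiff_snd.prodMk (hc.comp contDiff_fst).neg) _ hl2 (y, η)
  refine ⟨fun t => (γ t).1, fun t => (γ t).2, ⟨fun t => (h t).fst, fun t => (h t).snd⟩, ?_, ?_⟩
  · simp [h0]
  · simp [h0]

theorem ham_diff {d : ℕ} (M : ℝ) (hM : 0 < M) (V : EuclideanSpace ℝ (Fin d) → ℝ)
    (hV : ContDiff ℝ ∞ V) (hb : ∀ z, ‖iteratedFDeriv ℝ 2 V z‖ ≤ M)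
    (X Ξ X' Ξ' : ℝ → EuclideanSpace ℝ (Fin d)) (h : IsHamTraj V X Ξ) (h' : IsHamTraj V X' Ξ')
    (h0 : X 0 = X' 0) (t : ℝ) (ht : M * t ^ 2 ≤ 1 / 4) :
    ‖(X t - X' t) - t • (Ξ 0 - Ξ' 0)‖ ≤ |t| / 2 * ‖Ξ 0 - Ξ' 0‖ := by
  obtain ⟨-, hl⟩ := ham_lip M hM V hV hb
  refine ham_key M hM (fun s => X s - X' s) (fun s => Ξ s - Ξ' s) _
    (fun s => (h.1 s).sub (h'.1 s)) (fun s => (h.2 s).sub (h'.2 s)) (fun s => ?_)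
    (by simp [h0]) t ht
  have := hl.dist_le_mul (X s) (X' s)
  rw [Real.coe_toNNReal _ hM.le, dist_eq_norm, dist_eq_norm] at this
  rwa [neg_sub_neg, norm_sub_rev]

theorem stmt5 (M : ℝ) (hM : 0 < M) :
    ∃ δ₀ > 0, ∀ (d : ℕ), 1 ≤ d →
      ∀ V : EuclideanSpace ℝ (Fin d) → ℝ, ContDiff ℝ ∞ V →
      (∀ z, ‖iteratedFDeriv ℝ 2 V z‖ ≤ M) →
      ∀ t : ℝ, t ≠ 0 → |t| ≤ δ₀ →
      ∀ x y : EuclideanSpace ℝ (Fin d),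
        ∃! η : EuclideanSpace ℝ (Fin d),
          ∃ X Ξ : ℝ → EuclideanSpace ℝ (Fin d),
            IsHamTraj V X Ξ ∧ X 0 = y ∧ Ξ 0 = η ∧ X t = x := by
  refine ⟨1 / (2 * Real.sqrt M), by positivity, ?_⟩
  intro d _ V hV hb t ht0 ht x y
  have hMt : M * t ^ 2 ≤ 1 / 4 := by
    have h1 : |t| ^ 2 ≤ (1 / (2 * Real.sqrt M)) ^ 2 := by gcongr
    rw [sq_abs, div_pow, mul_pow, Real.sq_sqrt hM.le] at h1
    calc M * t ^ 2 ≤ M * (1 ^ 2 / (2 ^ 2 * M)) := by gcongr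
      _ = 1 / 4 := by field_simp; norm_num
  have htp : 0 < |t| := abs_pos.2 ht0
  choose X Ξ hT hX hΞ using fun η => ham_exists M hM V hV hb y η
  let T : EuclideanSpace ℝ (Fin d) → EuclideanSpace ℝ (Fin d) :=
    fun η => η - t⁻¹ • (X η t - x)
  have hTc : ContractingWith (1 / 2 : NNReal) T := by
    refine ⟨by rw [div_lt_one] <;> norm_num, LipschitzWith.of_dist_le_mul fun a b => ?_⟩
    have h := ham_diff M hM V hV hb _ _ _ _ (hT a) (hT b) (by rw [hX, hX]) t hMt
    rw [hΞ, hΞ] at h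
    have h2 : T a - T b = -(t⁻¹ • ((X a t - X b t) - t • (a - b))) := by
      simp only [T, smul_sub, smul_smul, inv_mul_cancel₀ ht0, one_smul]
      abel
    rw [dist_eq_norm, dist_eq_norm, h2, norm_neg, norm_smul, norm_inv, Real.norm_eq_abs]
    calc |t|⁻¹ * ‖(X a t - X b t) - t • (a - b)‖ ≤ |t|⁻¹ * (|t| / 2 * ‖a - b‖) := by gcongr
      _ = _ := by push_cast; field_simp
  refine ⟨hTc.fixedPoint T, ⟨X _, Ξ _, hT _, hX _, hΞ _, ?_⟩, ?_⟩
  · have h : T _ = _ := hTc.fixedPoint_isFixedPt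
    have h2 : t⁻¹ • (X (hTc.fixedPoint T) t - x) = 0 := by
      simpa only [T, sub_eq_self] using h
    rcases smul_eq_zero.1 h2 with h3 | h3
    · exact absurd h3 (inv_ne_zero ht0)
    · exact sub_eq_zero.1 h3
  · rintro η ⟨X', Ξ', hT', hX', hΞ', hx'⟩
    apply hTc.fixedPoint_unique
    have h := ham_diff M hM V hV hb _ _ _ _ (hT η) hT' (by rw [hX, hX']) t hMt
    rw [hΞ, hΞ', sub_self, smul_zero, norm_zero, mul_zero, sub_zero, hx'] at h
    have h2 : X η t - x = 0 := norm_le_zero_iff.1 h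
    change η - t⁻¹ • (X η t - x) = η
    rw [h2]; simp
end

section
/- Assume in addition that ‖∇V(z)‖ ≤ L(1 + ‖z‖) for all z. Then there are δ₀ > 0 and a constant C, depending only on M and L, such that: if 0 < t ≤ δ₀ and (x(·), ξ(·)) is a Hamiltonian trajectory with x(0) = y and x(t) = x, then ‖x(τ)‖ ≤ C(1 + ‖x‖ + ‖y‖) for all τ ∈ [0, t]. -/
open ContDiff

theorem stmt6 (M L : ℝ) (hM : 0 < M) (hL : 0 < L) :
    ∃ δ₀ > 0, ∃ C > 0, ∀ (d : ℕ), 1 ≤ d →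
      ∀ V : EuclideanSpace ℝ (Fin d) → ℝ, ContDiff ℝ ∞ V →
      (∀ z, ‖iteratedFDeriv ℝ 2 V z‖ ≤ M) →
      (∀ z, ‖gradient V z‖ ≤ L * (1 + ‖z‖)) →
      ∀ t : ℝ, 0 < t → t ≤ δ₀ →
      ∀ X Ξ : ℝ → EuclideanSpace ℝ (Fin d), IsHamTraj V X Ξ →
      ∀ x y : EuclideanSpace ℝ (Fin d), X 0 = y → X t = x →
        ∀ τ ∈ Set.Icc (0 : ℝ) t, ‖X τ‖ ≤ C * (1 + ‖x‖ + ‖y‖) := by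
  refine ⟨min 1 (1 / (4 * L)), by positivity, 4, by norm_num, ?_⟩
  intro d _ V _ _ hg t ht htd X Ξ hT x y hy hx
  obtain ⟨hX, hΞ⟩ := hT
  have ht1 : t ≤ 1 := htd.trans (min_le_left _ _)
  have ht2 : 4 * L * t ≤ 1 := by
    have h := htd.trans (min_le_right _ _)
    rw [le_div_iff₀ (by positivity)] at h
    linarith
  have h0 : (0 : ℝ) ∈ Set.Icc (0 : ℝ) t := ⟨le_refl _, ht.le⟩
  have htt : t ∈ Set.Icc (0 : ℝ) t := ⟨ht.le, le_refl _⟩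
  have hc : Continuous X := continuous_iff_continuousAt.2 fun s => (hX s).continuousAt
  obtain ⟨σ, hσ, hmax⟩ := isCompact_Icc.exists_isMaxOn ⟨0, h0⟩
    (hc.norm.continuousOn (s := Set.Icc (0 : ℝ) t))
  set m := ‖X σ‖ with hm
  have hm0 : 0 ≤ m := norm_nonneg _
  have hb : ∀ s ∈ Set.Icc (0 : ℝ) t, ‖X s‖ ≤ m := fun s hs => hmax hs
  set K := L * (1 + m) with hK
  have hK0 : 0 ≤ K := by positivity
  have h1 : ∀ s ∈ Set.Icc (0 : ℝ) t, ‖Ξ s - Ξ 0‖ ≤ K * t := by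
    intro s hs
    have h := Convex.norm_image_sub_le_of_norm_hasDerivWithin_le (C := K)
      (fun u (_ : u ∈ Set.Icc (0 : ℝ) t) => (hΞ u).hasDerivWithinAt) (by
        intro u hu
        rw [norm_neg]
        refine (hg _).trans ?_
        have := hb u hu
        rw [hK]
        gcongr) (convex_Icc _ _) h0 hs
    refine h.trans ?_
    rw [sub_zero, Real.norm_of_nonneg hs.1]
    exact mul_le_mul_of_nonneg_left hs.2 hK0
  have h2 : ∀ s ∈ Set.Icc (0 : ℝ) t, ‖X s - y - s • Ξ 0‖ ≤ K * t * t := by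
    intro s hs
    have h := Convex.norm_image_sub_le_of_norm_hasDerivWithin_le (C := K * t)
      (f := fun u => X u - u • Ξ 0) (f' := fun u => Ξ u - Ξ 0)
      (fun u (_ : u ∈ Set.Icc (0 : ℝ) t) => by
        have := (hX u).sub ((hasDerivAt_id u).smul_const (Ξ 0))
        rw [one_smul] at this
        exact this.hasDerivWithinAt) h1 (convex_Icc _ _) h0 hs
    simp only [zero_smul, sub_zero, hy] at h
    rw [sub_right_comm]
    refine h.trans ?_
    rw [Real.norm_of_nonneg hs.1]
    exact mul_le_mul_of_nonneg_left hs.2 (by positivity)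
  have h3 : ‖t • Ξ 0‖ ≤ ‖x‖ + ‖y‖ + K * t * t := by
    have e : t • Ξ 0 = x - y - (x - y - t • Ξ 0) := by abel
    have h := h2 t htt
    rw [hx] at h
    rw [e]
    have := norm_sub_le (x - y) (x - y - t • Ξ 0)
    have := norm_sub_le x y
    linarith
  have h4 : m ≤ ‖x‖ + 2 * ‖y‖ + 2 * (K * t * t) := by
    have e : X σ = (X σ - y - σ • Ξ 0) + y + σ • Ξ 0 := by abel
    have h := h2 σ hσ
    have h5 : ‖σ • Ξ 0‖ ≤ ‖t • Ξ 0‖ := by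
      rw [norm_smul, norm_smul, Real.norm_of_nonneg hσ.1, Real.norm_of_nonneg ht.le]
      exact mul_le_mul_of_nonneg_right hσ.2 (norm_nonneg _)
    have h6 := norm_add₃_le (a := X σ - y - σ • Ξ 0) (b := y) (c := σ • Ξ 0)
    rw [← e] at h6
    linarith
  have h7 : 4 * (K * t * t) ≤ 1 + m := by
    have a : 4 * L * t * t ≤ 1 := by nlinarith
    have : 4 * (K * t * t) = (4 * L * t * t) * (1 + m) := by rw [hK]; ring
    rw [this]
    nlinarith
  intro τ hτ
  have := hb τ hτ
  have := norm_nonneg x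
  have := norm_nonneg y
  linarith
end

section
/- Assume in addition that ‖∇V(z)‖ ≤ L(1 + ‖z‖) for all z. Then there are δ₀ > 0 and a constant C, depending only on M and L, such that: if 0 < t ≤ δ₀ and (x(·), ξ(·)) is a Hamiltonian trajectory with x(0) = y and x(t) = x, then the trajectory stays close to the straight line from y to x in the quantitative sense that ‖x(τ) − y − (τ/t)(x − y)‖ ≤ C (τ t + τ²)(1 + ‖x‖ + ‖y‖) for all τ ∈ [0, t]. -/
open ContDiff

theorem stmt7 (M L : ℝ) (hM : 0 < M) (hL : 0 < L) :
    ∃ δ₀ > 0, ∃ C > 0, ∀ (d : ℕ), 1 ≤ d →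
      ∀ V : EuclideanSpace ℝ (Fin d) → ℝ, ContDiff ℝ ∞ V →
      (∀ z, ‖iteratedFDeriv ℝ 2 V z‖ ≤ M) →
      (∀ z, ‖gradient V z‖ ≤ L * (1 + ‖z‖)) →
      ∀ t : ℝ, 0 < t → t ≤ δ₀ →
      ∀ X Ξ : ℝ → EuclideanSpace ℝ (Fin d), IsHamTraj V X Ξ →
      ∀ x y : EuclideanSpace ℝ (Fin d), X 0 = y → X t = x →
        ∀ τ ∈ Set.Icc (0 : ℝ) t,
          ‖X τ - y - (τ / t) • (x - y)‖ ≤ C * (τ * t + τ ^ 2) * (1 + ‖x‖ + ‖y‖) := by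
  refine ⟨1 / (1 + 2 * L), by positivity, 2 * L, by positivity, ?_⟩
  intro d _ V _ _ hg t ht htδ X Ξ hX x y hx0 hxt
  obtain ⟨h1, h2⟩ := hX
  have hcont : Continuous X := continuous_iff_continuousAt.2 fun s => (h1 s).continuousAt
  obtain ⟨s, hs, hmax⟩ := isCompact_Icc.exists_isMaxOn (Set.nonempty_Icc.2 ht.le)
    (hcont.norm.continuousOn (s := Set.Icc 0 t))
  have hmax' : ∀ r ∈ Set.Icc (0:ℝ) t, ‖X r‖ ≤ ‖X s‖ := fun r hr => hmax hr
  obtain ⟨A, hA⟩ : ∃ A, A = ‖X s‖ := ⟨_, rfl⟩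
  rw [← hA] at hmax'
  have hA0 : 0 ≤ A := hA ▸ norm_nonneg _
  obtain ⟨G, hG⟩ : ∃ G, G = L * (1 + A) := ⟨_, rfl⟩
  have hG0 : 0 ≤ G := by rw [hG]; positivity
  -- velocity variation
  have hΞ : ∀ a ∈ Set.Icc (0:ℝ) t, ∀ b ∈ Set.Icc (0:ℝ) t, ‖Ξ b - Ξ a‖ ≤ G * t := by
    intro a ha b hb
    have := (convex_Icc (0:ℝ) t).norm_image_sub_le_of_norm_hasDerivWithin_le (f := Ξ)
      (C := G) (fun r _ => (h2 r).hasDerivWithinAt) (fun r hr => by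
        rw [norm_neg, hG]
        exact (hg _).trans (by gcongr; exact hmax' r hr)) ha hb
    refine this.trans ?_
    gcongr
    rw [Real.norm_eq_abs, abs_le]
    constructor <;> linarith [ha.1, ha.2, hb.1, hb.2]
  have hlin : ∀ (v : EuclideanSpace ℝ (Fin d)), ∀ r : ℝ,
      HasDerivAt (fun r => X r - r • v) (Ξ r - v) r := by
    intro v r
    have := (h1 r).sub ((hasDerivAt_id r).smul_const v)
    rw [one_smul] at this
    exact this
  have h0 : (0:ℝ) ∈ Set.Icc 0 t := ⟨le_rfl, ht.le⟩
  have h1t : t ∈ Set.Icc 0 t := ⟨ht.le, le_rfl⟩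
  have hW : ∀ a ∈ Set.Icc (0:ℝ) t, ‖Ξ a - (1 / t) • (x - y)‖ ≤ G * t := by
    intro a ha
    have := (convex_Icc (0:ℝ) t).norm_image_sub_le_of_norm_hasDerivWithin_le
      (C := G * t) (fun r _ => (hlin (Ξ a) r).hasDerivWithinAt)
      (fun r hr => hΞ a ha r hr) h0 h1t
    simp only [hx0, hxt, zero_smul, sub_zero, Real.norm_eq_abs, abs_of_pos ht] at this
    have e : x - t • Ξ a - y = (-t) • (Ξ a - (1 / t) • (x - y)) := by
      rw [smul_sub, smul_smul]
      have : -t * (1 / t) = -1 := by field_simp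
      rw [this]; module
    rw [e, norm_smul, norm_neg, Real.norm_eq_abs, abs_of_pos ht] at this
    nlinarith
  have hE : ∀ r ∈ Set.Icc (0:ℝ) t, ‖X r - y - (r / t) • (x - y)‖ ≤ G * t * r := by
    intro r hr
    have := (convex_Icc (0:ℝ) t).norm_image_sub_le_of_norm_hasDerivWithin_le
      (C := G * t) (fun r _ => (hlin ((1 / t) • (x - y)) r).hasDerivWithinAt)
      (fun r hr => hW r hr) h0 hr
    simp only [hx0, zero_mul, zero_smul, sub_zero, Real.norm_eq_abs, abs_of_nonneg hr.1, smul_smul] at this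
    have e : X r - y - (r / t) • (x - y) = X r - (r * (1 / t)) • (x - y) - y := by
      rw [mul_one_div]; abel
    rw [e]; exact this
  have hLt : L * (t * t) ≤ 1 / 2 := by
    rw [le_div_iff₀ (by positivity)] at htδ
    have : t ≤ 1 := by nlinarith
    nlinarith [mul_pos hL ht]
  have hAb : 1 + A ≤ 2 * (1 + ‖x‖ + ‖y‖) := by
    have hb : A ≤ ‖x‖ + ‖y‖ + G * t * s := by
      have hq0 : 0 ≤ s / t := div_nonneg hs.1 ht.le
      have hq1 : s / t ≤ 1 := (div_le_one ht).2 hs.2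
      have e : X s = (s / t) • x + (1 - s / t) • y + (X s - y - (s / t) • (x - y)) := by module
      rw [hA]
      calc ‖X s‖ = ‖(s / t) • x + (1 - s / t) • y + (X s - y - (s / t) • (x - y))‖ := by rw [← e]
        _ ≤ ‖(s / t) • x‖ + ‖(1 - s / t) • y‖ + ‖X s - y - (s / t) • (x - y)‖ := norm_add₃_le
        _ ≤ _ := by
          rw [norm_smul, norm_smul, Real.norm_eq_abs, Real.norm_eq_abs, abs_of_nonneg hq0,
            abs_of_nonneg (by linarith : 0 ≤ 1 - s / t)]
          nlinarith [hE s hs, norm_nonneg x, norm_nonneg y]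
    have h3 : G * t * s ≤ G * t * t := by
      have := hs.2
      gcongr
    have h4 : G * t * t ≤ 1 / 2 * (1 + A) := by
      have : G * t * t = L * (t * t) * (1 + A) := by rw [hG]; ring
      rw [this]; gcongr
    linarith [norm_nonneg x, norm_nonneg y]
  intro τ hτ
  refine (hE τ hτ).trans ?_
  have hτ0 := hτ.1
  calc G * t * τ = L * (τ * t) * (1 + A) := by rw [hG]; ring
    _ ≤ L * (τ * t + τ ^ 2) * (2 * (1 + ‖x‖ + ‖y‖)) := by
      gcongr
      nlinarith
    _ = _ := by ring
end

section
/- Assume in addition that ‖∇V(z)‖ ≤ L(1 + ‖z‖) for all z. Then there are δ₀ > 0 and a constant C, depending only on M and L, such that: if 0 < t ≤ δ₀ and (x(·), ξ(·)) is a Hamiltonian trajectory with x(0) = y and x(t) = x, then ∫₀ᵗ |V(x(τ)) − V(y + (τ/t)(x − y))| dτ ≤ C t³ (1 + ‖x‖ + ‖y‖)². -/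
open ContDiff

theorem stmt8 (M L : ℝ) (hM : 0 < M) (hL : 0 < L) :
    ∃ δ₀ > 0, ∃ C > 0, ∀ (d : ℕ), 1 ≤ d →
      ∀ V : EuclideanSpace ℝ (Fin d) → ℝ, ContDiff ℝ ∞ V →
      (∀ z, ‖iteratedFDeriv ℝ 2 V z‖ ≤ M) →
      (∀ z, ‖gradient V z‖ ≤ L * (1 + ‖z‖)) →
      ∀ t : ℝ, 0 < t → t ≤ δ₀ →
      ∀ X Ξ : ℝ → EuclideanSpace ℝ (Fin d), IsHamTraj V X Ξ →
      ∀ x y : EuclideanSpace ℝ (Fin d), X 0 = y → X t = x →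
        (∫ τ in (0 : ℝ)..t, |V (X τ) - V (y + (τ / t) • (x - y))|)
          ≤ C * t ^ 3 * (1 + ‖x‖ + ‖y‖) ^ 2 := by
  refine ⟨min 1 (1 / (4 * L)), by positivity, 8 * L ^ 2, by positivity, ?_⟩
  intro d _ V hV _ hG t ht htδ X Ξ hX x y hx0 hxt
  have ht1 : t ≤ 1 := htδ.trans (min_le_left _ _)
  have ht2 : t * (4 * L) ≤ 1 := by
    have := htδ.trans (min_le_right _ _)
    rwa [le_div_iff₀ (by positivity)] at this
  have hLt : 2 * L * t ^ 2 ≤ 1 / 2 := by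
    have : L * t * t ≤ L * t * 1 := by gcongr
    nlinarith
  obtain ⟨h1, h2⟩ := hX
  have hXc : Continuous X := continuous_iff_continuousAt.2 fun s => (h1 s).continuousAt
  obtain ⟨s₀, hs₀, hmax⟩ := (isCompact_Icc (a := (0 : ℝ)) (b := t)).exists_isMaxOn
    ⟨0, by simp [ht.le]⟩ hXc.norm.continuousOn
  set R := ‖X s₀‖ with hR
  have hRmax : ∀ s ∈ Set.Icc (0 : ℝ) t, ‖X s‖ ≤ R := fun s hs => hmax hs
  have hR0 : 0 ≤ R := norm_nonneg _
  set K := L * (1 + R) with hK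
  have hK0 : 0 ≤ K := by positivity
  have h0m : (0 : ℝ) ∈ Set.Icc (0 : ℝ) t := ⟨le_rfl, ht.le⟩
  have hΞ : ∀ s ∈ Set.Icc (0 : ℝ) t, ‖Ξ s - Ξ 0‖ ≤ K * t := by
    intro s hs
    have := (convex_Icc (0 : ℝ) t).norm_image_sub_le_of_norm_hasDerivWithin_le (C := K)
      (fun u _ => (h2 u).hasDerivWithinAt) (fun u hu => by
        rw [norm_neg]
        refine (hG _).trans ?_
        have := hRmax u hu
        rw [hK]; gcongr) h0m hs
    refine this.trans ?_
    rw [sub_zero, Real.norm_of_nonneg hs.1]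
    have := hs.2
    gcongr
  have he : ∀ s ∈ Set.Icc (0 : ℝ) t, ‖X s - y - s • Ξ 0‖ ≤ K * t * t := by
    intro s hs
    have := (convex_Icc (0 : ℝ) t).norm_image_sub_le_of_norm_hasDerivWithin_le (C := K * t)
      (f := fun u => X u - u • Ξ 0) (f' := fun u => Ξ u - (1 : ℝ) • Ξ 0)
      (fun u _ => ((h1 u).sub ((hasDerivAt_id u).smul_const (Ξ 0))).hasDerivWithinAt)
      (fun u hu => by
        rw [one_smul]; exact hΞ u hu) h0m hs
    simp only [zero_smul, sub_zero, hx0, Real.norm_of_nonneg hs.1] at this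
    rw [sub_right_comm]
    refine this.trans ?_
    have := hs.2
    gcongr
  have hw : ∀ s ∈ Set.Icc (0 : ℝ) t, ‖X s - (y + (s / t) • (x - y))‖ ≤ 2 * K * t ^ 2 := by
    intro s hs
    have e1 : X s - (y + (s / t) • (x - y))
        = (X s - y - s • Ξ 0) - (s / t) • (X t - y - t • Ξ 0) := by
      rw [hxt, smul_sub _ (x - y), smul_smul, div_mul_cancel₀ _ ht.ne']
      abel
    have hst : s / t ≤ 1 := (div_le_one ht).2 hs.2
    have hst0 : 0 ≤ s / t := div_nonneg hs.1 ht.le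
    have a := he s hs
    have b := he t ⟨ht.le, le_rfl⟩
    rw [e1]
    refine (norm_sub_le _ _).trans ?_
    rw [norm_smul, Real.norm_of_nonneg hst0]
    have c := mul_le_of_le_one_left (norm_nonneg (X t - y - t • Ξ 0)) hst
    linarith
  have hline : ∀ s ∈ Set.Icc (0 : ℝ) t, ‖y + (s / t) • (x - y)‖ ≤ ‖x‖ + ‖y‖ := by
    intro s hs
    have hst : s / t ≤ 1 := (div_le_one ht).2 hs.2
    have hst0 : 0 ≤ s / t := div_nonneg hs.1 ht.le
    have e1 : y + (s / t) • (x - y) = (s / t) • x + (1 - s / t) • y := by module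
    rw [e1]
    refine (norm_add_le _ _).trans ?_
    rw [norm_smul, norm_smul, Real.norm_of_nonneg hst0, Real.norm_of_nonneg (by linarith)]
    have c := mul_le_of_le_one_left (norm_nonneg x) hst
    have c' := mul_le_of_le_one_left (norm_nonneg y) (show 1 - s / t ≤ 1 by linarith)
    linarith
  set S := 1 + ‖x‖ + ‖y‖ with hS
  have hS0 : 0 < S := by positivity
  have hRS : 1 + R ≤ 2 * S := by
    have a := hw s₀ hs₀
    have b := hline s₀ hs₀
    have c : R ≤ ‖X s₀ - (y + (s₀ / t) • (x - y))‖ + ‖y + (s₀ / t) • (x - y)‖ := by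
      simpa using norm_add_le (X s₀ - (y + (s₀ / t) • (x - y))) (y + (s₀ / t) • (x - y))
    have e : 2 * K * t ^ 2 ≤ 1 / 2 * (1 + R) := by
      calc 2 * K * t ^ 2 = 2 * L * t ^ 2 * (1 + R) := by rw [hK]; ring
        _ ≤ _ := by gcongr
    linarith
  have hKS : K ≤ 2 * L * S := by
    calc K ≤ L * (2 * S) := by rw [hK]; gcongr
      _ = _ := by ring
  have hVd : Differentiable ℝ V := hV.differentiable (by simp)
  have hpt : ∀ s ∈ Set.Icc (0 : ℝ) t,
      |V (X s) - V (y + (s / t) • (x - y))| ≤ 8 * L ^ 2 * t ^ 2 * S ^ 2 := by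
    intro s hs
    have := (convex_closedBall (0 : EuclideanSpace ℝ (Fin d)) (2 * S - 1)).norm_image_sub_le_of_norm_fderiv_le
      (f := V) (𝕜 := ℝ) (C := 2 * L * S) (fun z _ => hVd z) (fun z hz => by
        have hz' : ‖z‖ ≤ 2 * S - 1 := by simpa using hz
        have e : ‖fderiv ℝ V z‖ = ‖gradient V z‖ := by simp [gradient]
        rw [e]
        refine (hG z).trans ?_
        calc L * (1 + ‖z‖) ≤ L * (2 * S) := by gcongr; linarith
          _ = _ := by ring)
      (x := y + (s / t) • (x - y)) (y := X s)
      (by have := hline s hs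
          rw [mem_closedBall_zero_iff]
          have := norm_nonneg x
          have := norm_nonneg y
          linarith)
      (by have := hRmax s hs
          rw [mem_closedBall_zero_iff]
          linarith)
    rw [Real.norm_eq_abs] at this
    refine this.trans ?_
    calc 2 * L * S * ‖X s - (y + (s / t) • (x - y))‖
        ≤ 2 * L * S * (2 * (2 * L * S) * t ^ 2) := by
          gcongr
          refine (hw s hs).trans ?_
          gcongr
      _ = _ := by ring
  have hfin := intervalIntegral.norm_integral_le_of_norm_le_const (a := 0) (b := t)
    (f := fun τ => |V (X τ) - V (y + (τ / t) • (x - y))|) (C := 8 * L ^ 2 * t ^ 2 * S ^ 2)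
    (fun s hs => by
      rw [Set.uIoc_of_le ht.le] at hs
      rw [Real.norm_eq_abs, abs_abs]
      exact hpt s ⟨hs.1.le, hs.2⟩)
  refine (le_abs_self _).trans (hfin.trans (le_of_eq ?_))
  rw [sub_zero, abs_of_pos ht]
  ring
end

section
/- Assume in addition that ‖∇V(z)‖ ≤ L(1 + ‖z‖) for all z. Let (x(·), ξ(·)) be a Hamiltonian trajectory with x(0) = y, ξ(0) = η and x(t) = x for some t > 0. Then the initial momentum satisfies the identity η = (x − y)/t + (1/t)∫₀ᵗ (t − θ) ∇V(x(θ)) dθ. Moreover there are δ₀ > 0 and C, depending only on M and L, such that if 0 < t ≤ δ₀ then ‖ξ(τ) − (x − y)/t‖ ≤ C t (1 + ‖x‖ + ‖y‖) for all τ ∈ [0, t]. -/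
open ContDiff

theorem stmt9 (M L : ℝ) (hM : 0 < M) (hL : 0 < L) :
    ∃ δ₀ > 0, ∃ C > 0, ∀ (d : ℕ), 1 ≤ d →
      ∀ V : EuclideanSpace ℝ (Fin d) → ℝ, ContDiff ℝ ∞ V →
      (∀ z, ‖iteratedFDeriv ℝ 2 V z‖ ≤ M) →
      (∀ z, ‖gradient V z‖ ≤ L * (1 + ‖z‖)) →
      ∀ t : ℝ, 0 < t →
      ∀ X Ξ : ℝ → EuclideanSpace ℝ (Fin d), IsHamTraj V X Ξ →
      ∀ x y η : EuclideanSpace ℝ (Fin d), X 0 = y → Ξ 0 = η → X t = x →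
        (η = t⁻¹ • (x - y)
            + t⁻¹ • (∫ θ in (0 : ℝ)..t, (t - θ) • gradient V (X θ))) ∧
        (t ≤ δ₀ → ∀ τ ∈ Set.Icc (0 : ℝ) t,
          ‖Ξ τ - t⁻¹ • (x - y)‖ ≤ C * t * (1 + ‖x‖ + ‖y‖)) := by
  refine ⟨1 / (1 + 4 * L), by positivity, 4 * L, by positivity, ?_⟩
  intro d _ V hV _ hg t ht X Ξ hT x y η hX0 hΞ0 hXt
  obtain ⟨hX, hΞ⟩ := hT
  have hXc : Continuous X := continuous_iff_continuousAt.2 fun s => (hX s).continuousAt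
  have hgc : Continuous (gradient V) := by
    have h1 : Continuous (fderiv ℝ V) := hV.continuous_fderiv (by simp)
    exact (InnerProductSpace.toDual ℝ (EuclideanSpace ℝ (Fin d))).symm.continuous.comp h1
  have hgX : Continuous fun θ => gradient V (X θ) := hgc.comp hXc
  have hF : ∀ θ : ℝ, HasDerivAt (fun θ => -((t - θ) • Ξ θ + X θ))
      ((t - θ) • gradient V (X θ)) θ := by
    intro θ
    have h1 : HasDerivAt (fun θ : ℝ => t - θ) (-1) θ := by
      simpa using (hasDerivAt_id θ).const_sub t
    have h2 := ((h1.smul (hΞ θ)).add (hX θ)).neg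
    refine HasDerivAt.congr_deriv (f := fun θ => -((t - θ) • Ξ θ + X θ)) h2 ?_
    module
  have hint : ∫ θ in (0 : ℝ)..t, (t - θ) • gradient V (X θ) = t • η - (x - y) := by
    rw [intervalIntegral.integral_eq_sub_of_hasDerivAt (fun θ _ => hF θ)]
    · simp only [hXt, hX0, hΞ0]
      module
    · apply Continuous.intervalIntegrable
      fun_prop
  have hid : η = t⁻¹ • (x - y)
      + t⁻¹ • (∫ θ in (0 : ℝ)..t, (t - θ) • gradient V (X θ)) := by
    rw [hint, ← smul_add, add_sub_cancel, smul_smul, inv_mul_cancel₀ ht.ne', one_smul]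
  refine ⟨hid, ?_⟩
  intro htδ
  obtain ⟨s, hs, hmax⟩ := isCompact_Icc.exists_isMaxOn (Set.nonempty_Icc.2 ht.le)
    (hXc.norm.continuousOn (s := Set.Icc 0 t))
  set A := L * (1 + ‖X s‖) with hA
  have hA0 : 0 ≤ A := by positivity
  have hgA : ∀ θ ∈ Set.Icc (0 : ℝ) t, ‖gradient V (X θ)‖ ≤ A := by
    intro θ hθ
    have := hmax hθ
    simp only [Set.mem_ofPred_eq] at this
    refine (hg _).trans ?_
    rw [hA]
    gcongr
  set v := t⁻¹ • (x - y) with hv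
  have h1 : ‖η - v‖ ≤ A * t := by
    have e : η - v = t⁻¹ • (∫ θ in (0 : ℝ)..t, (t - θ) • gradient V (X θ)) := by
      rw [sub_eq_iff_eq_add']
      exact hid
    rw [e, norm_smul, norm_inv, Real.norm_of_nonneg ht.le]
    have : ‖∫ θ in (0 : ℝ)..t, (t - θ) • gradient V (X θ)‖ ≤ (t * A) * |t - 0| := by
      apply intervalIntegral.norm_integral_le_of_norm_le_const
      intro θ hθ
      rw [Set.uIoc_of_le ht.le] at hθ
      rw [norm_smul, Real.norm_of_nonneg (by linarith [hθ.2])]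
      have := hgA θ ⟨hθ.1.le, hθ.2⟩
      have h3 := hθ.1
      gcongr
      linarith
    rw [sub_zero, abs_of_pos ht] at this
    rw [inv_mul_le_iff₀ ht]
    linarith
  have h2 : ∀ τ ∈ Set.Icc (0 : ℝ) t, ‖Ξ τ - v‖ ≤ 2 * A * t := by
    intro τ hτ
    have h3 : ‖Ξ τ - Ξ 0‖ ≤ A * (τ - 0) :=
      norm_image_sub_le_of_norm_deriv_le_segment' (fun θ _ => (hΞ θ).hasDerivWithinAt)
        (fun θ hθ => by
          rw [norm_neg]
          exact hgA θ ⟨hθ.1, hθ.2.le⟩) τ hτ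
    have h4 : A * (τ - 0) ≤ A * t := by
      have := hτ.2
      gcongr
      linarith
    have h5 : Ξ τ - v = (Ξ τ - Ξ 0) + (η - v) := by rw [hΞ0]; abel
    rw [h5]
    linarith [norm_add_le (Ξ τ - Ξ 0) (η - v)]
  have h6 : ‖X s‖ ≤ ‖x‖ + ‖y‖ + 2 * A * t * t := by
    have h3 : ‖(X s - s • v) - (X 0 - (0 : ℝ) • v)‖ ≤ 2 * A * t * (s - 0) := by
      refine norm_image_sub_le_of_norm_deriv_le_segment' (f := fun θ => X θ - θ • v)
        (f' := fun θ => Ξ θ - v) (fun θ _ => ?_)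
        (fun θ hθ => h2 θ ⟨hθ.1, hθ.2.le⟩) s hs
      have := (hX θ).sub ((hasDerivAt_id θ).smul_const v)
      simp only [one_smul] at this
      exact this.hasDerivWithinAt
    have h4 : 2 * A * t * (s - 0) ≤ 2 * A * t * t := by
      have := hs.2
      gcongr
      linarith
    have hr0 : 0 ≤ s * t⁻¹ := mul_nonneg hs.1 (inv_nonneg.2 ht.le)
    have hr1 : s * t⁻¹ ≤ 1 := by
      rw [← div_eq_mul_inv, div_le_one ht]
      exact hs.2
    have h5 : X s = ((X s - s • v) - (X 0 - (0 : ℝ) • v))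
        + ((s * t⁻¹) • x + (1 - s * t⁻¹) • y) := by
      rw [hX0, hv]
      module
    have h7 : ‖(s * t⁻¹) • x‖ ≤ ‖x‖ := by
      rw [norm_smul, Real.norm_of_nonneg hr0]
      exact mul_le_of_le_one_left (norm_nonneg _) hr1
    have h8 : ‖(1 - s * t⁻¹) • y‖ ≤ ‖y‖ := by
      rw [norm_smul, Real.norm_of_nonneg (by linarith)]
      exact mul_le_of_le_one_left (norm_nonneg _) (by linarith)
    rw [h5]
    refine (norm_add_le _ _).trans ?_
    linarith [norm_add_le ((s * t⁻¹) • x) ((1 - s * t⁻¹) • y)]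
  have h9 : t * (1 + 4 * L) ≤ 1 := by
    rwa [le_div_iff₀ (by positivity)] at htδ
  have h10 : 4 * L * t * t ≤ 1 := by
    have : 0 < 4 * L * t := by positivity
    have a1 : t ≤ 1 := by linarith
    have a2 : 4 * L * t ≤ 1 := by linarith
    nlinarith
  have h11 : 1 + ‖X s‖ ≤ 2 * (1 + ‖x‖ + ‖y‖) := by
    have := mul_le_mul_of_nonneg_right h10 (by positivity : 0 ≤ 1 + ‖X s‖)
    have e : 2 * A * t * t = (4 * L * t * t * (1 + ‖X s‖)) / 2 := by rw [hA]; ring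
    linarith
  intro τ hτ
  refine (h2 τ hτ).trans ?_
  have := mul_le_mul_of_nonneg_left h11 (by positivity : 0 ≤ 2 * L * t)
  rw [hA]
  linarith
end

section
/- Assume in addition that ‖∇V(z)‖ ≤ L(1 + ‖z‖) for all z. Then there are δ₀ > 0 and a constant C, depending only on M and L, such that: if 0 < t ≤ δ₀ and (x(·), ξ(·)) is a Hamiltonian trajectory with x(0) = y and x(t) = x, then the kinetic part of the action satisfies |∫₀ᵗ ½‖ξ(τ)‖² dτ − ‖x − y‖²/(2t)| ≤ C t³ (1 + ‖x‖ + ‖y‖)². -/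
open ContDiff

theorem stmt10 (M L : ℝ) (hM : 0 < M) (hL : 0 < L) :
    ∃ δ₀ > 0, ∃ C > 0, ∀ (d : ℕ), 1 ≤ d →
      ∀ V : EuclideanSpace ℝ (Fin d) → ℝ, ContDiff ℝ ∞ V →
      (∀ z, ‖iteratedFDeriv ℝ 2 V z‖ ≤ M) →
      (∀ z, ‖gradient V z‖ ≤ L * (1 + ‖z‖)) →
      ∀ t : ℝ, 0 < t → t ≤ δ₀ →
      ∀ X Ξ : ℝ → EuclideanSpace ℝ (Fin d), IsHamTraj V X Ξ →
      ∀ x y : EuclideanSpace ℝ (Fin d), X 0 = y → X t = x →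
        |(∫ τ in (0 : ℝ)..t, (1 / 2) * ‖Ξ τ‖ ^ 2) - ‖x - y‖ ^ 2 / (2 * t)|
          ≤ C * t ^ 3 * (1 + ‖x‖ + ‖y‖) ^ 2 := by
  refine ⟨1 / (2 * (1 + L)), by positivity, 8 * L ^ 2, by positivity, ?_⟩
  intro d _ V _ _ hg t ht htd X Ξ hT x y hy hx
  obtain ⟨hX, hΞ⟩ := hT
  rw [le_div_iff₀ (by positivity)] at htd
  have htL : t * L ≤ 1 / 2 := by nlinarith
  have ht1 : t ≤ 1 / 2 := by nlinarith [mul_pos ht hL]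
  have hXc : Continuous X := continuous_iff_continuousAt.2 fun s => (hX s).continuousAt
  have hΞc : Continuous Ξ := continuous_iff_continuousAt.2 fun s => (hΞ s).continuousAt
  obtain ⟨s₀, hs₀, hmax⟩ := (isCompact_Icc (a := (0:ℝ)) (b := t)).exists_isMaxOn
    ⟨0, by simp [ht.le]⟩ (f := fun s => ‖X s‖) hXc.norm.continuousOn
  set S := ‖X s₀‖ with hS
  have hS0 : 0 ≤ S := norm_nonneg _
  have hmax' : ∀ s ∈ Set.Icc (0:ℝ) t, ‖X s‖ ≤ S := fun s hs => hmax hs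
  set K := L * (1 + S) with hK
  have hK0 : 0 ≤ K := by positivity
  have h1 : ∀ a ∈ Set.Icc (0:ℝ) t, ∀ b ∈ Set.Icc (0:ℝ) t, ‖Ξ b - Ξ a‖ ≤ K * t := by
    intro a ha b hb
    have := (convex_Icc (0:ℝ) t).norm_image_sub_le_of_norm_hasDerivWithin_le (C := K)
      (fun s _ => (hΞ s).hasDerivWithinAt)
      (fun s hs => by
        rw [norm_neg]
        exact (hg _).trans (by have := hmax' s hs; rw [hK]; gcongr)) ha hb
    refine this.trans ?_
    gcongr
    rw [Real.norm_eq_abs, abs_le]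
    constructor <;> linarith [ha.1, ha.2, hb.1, hb.2]
  set v := (1 / t) • (x - y) with hv
  have htv : t • v = x - y := by
    rw [hv, smul_smul, mul_one_div_cancel ht.ne', one_smul]
  clear_value v
  have h0m : (0:ℝ) ∈ Set.Icc (0:ℝ) t := ⟨le_rfl, ht.le⟩
  have htm : t ∈ Set.Icc (0:ℝ) t := ⟨ht.le, le_rfl⟩
  have hD : ∀ w : EuclideanSpace ℝ (Fin d), ∀ s,
      HasDerivAt (fun s => X s - s • w) (Ξ s - w) s := by
    intro w s
    have h := (hX s).sub ((hasDerivAt_id s).smul_const w)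
    rw [one_smul] at h
    exact h
  have h2 : ∀ s ∈ Set.Icc (0:ℝ) t, ‖Ξ s - v‖ ≤ K * t := by
    intro s hs
    have := (convex_Icc (0:ℝ) t).norm_image_sub_le_of_norm_hasDerivWithin_le (C := K * t)
      (fun r _ => (hD (Ξ s) r).hasDerivWithinAt)
      (fun r hr => h1 s hs r hr) h0m htm
    have e : X t - t • Ξ s - (X 0 - (0:ℝ) • Ξ s) = - (t • (Ξ s - v)) := by
      rw [smul_sub, htv, hx, hy, zero_smul]; abel
    rw [e, norm_neg, norm_smul, sub_zero, Real.norm_of_nonneg ht.le, mul_comm] at this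
    exact le_of_mul_le_mul_right this ht
  have h3 : S ≤ 2 * (‖x‖ + ‖y‖) + K * t * t := by
    have := (convex_Icc (0:ℝ) t).norm_image_sub_le_of_norm_hasDerivWithin_le (C := K * t)
      (fun r _ => (hD v r).hasDerivWithinAt) h2 h0m hs₀
    rw [sub_zero, Real.norm_of_nonneg hs₀.1] at this
    have e : X s₀ = (X s₀ - s₀ • v - (X 0 - (0:ℝ) • v)) + (y + s₀ • v) := by
      rw [hy, zero_smul]; abel
    have h4 : ‖s₀ • v‖ ≤ ‖x‖ + ‖y‖ := by
      calc ‖s₀ • v‖ ≤ ‖t • v‖ := by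
            rw [norm_smul, norm_smul, Real.norm_of_nonneg ht.le, Real.norm_of_nonneg hs₀.1]
            gcongr
            exact hs₀.2
        _ ≤ _ := by rw [htv]; exact norm_sub_le _ _
    have h5 : ‖X s₀‖ ≤ ‖X s₀ - s₀ • v - (X 0 - (0:ℝ) • v)‖ + (‖y‖ + ‖s₀ • v‖) := by
      conv_lhs => rw [e]
      exact (norm_add_le _ _).trans (by gcongr; exact norm_add_le _ _)
    have h6 : K * t * s₀ ≤ K * t * t := by gcongr; exact hs₀.2
    rw [hS]
    linarith [norm_nonneg x]
  have h7 : K * t * t ≤ (1 + S) / 4 := by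
    have : K * t * t = (1 + S) * ((t * L) * t) := by rw [hK]; ring
    rw [this]
    have : (t * L) * t ≤ 1 / 2 * (1 / 2) := by gcongr
    nlinarith
  have h8 : 1 + S ≤ 4 * (1 + ‖x‖ + ‖y‖) := by linarith [norm_nonneg x, norm_nonneg y]
  have hFTC : ∫ τ in (0:ℝ)..t, inner ℝ v (Ξ τ) = inner ℝ v (x - y) := by
    rw [intervalIntegral.integral_eq_sub_of_hasDerivAt (f := fun τ => inner ℝ v (X τ))
      (fun s _ => by simpa using (hasDerivAt_const s v).inner ℝ (hX s))
      (Continuous.intervalIntegrable (by fun_prop) _ _)]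
    rw [hx, hy, inner_sub_right]
  have hid : (∫ τ in (0 : ℝ)..t, (1 / 2) * ‖Ξ τ‖ ^ 2) - ‖x - y‖ ^ 2 / (2 * t)
      = ∫ τ in (0:ℝ)..t, (1 / 2) * ‖Ξ τ - v‖ ^ 2 := by
    have e : ∀ τ, (1 / 2) * ‖Ξ τ - v‖ ^ 2
        = (1 / 2) * ‖Ξ τ‖ ^ 2 - inner ℝ v (Ξ τ) + (1 / 2) * ‖v‖ ^ 2 := by
      intro τ
      rw [norm_sub_sq_real, real_inner_comm]; ring
    simp_rw [e]
    rw [intervalIntegral.integral_add (Continuous.intervalIntegrable (by fun_prop) _ _)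
      (Continuous.intervalIntegrable (by fun_prop) _ _),
      intervalIntegral.integral_sub (Continuous.intervalIntegrable (by fun_prop) _ _)
      (Continuous.intervalIntegrable (by fun_prop) _ _), hFTC,
      intervalIntegral.integral_const, ← htv, inner_smul_right, real_inner_self_eq_norm_sq,
      norm_smul, Real.norm_of_nonneg ht.le, smul_eq_mul]
    field_simp
    ring
  rw [hid, ← Real.norm_eq_abs]
  have hb := intervalIntegral.norm_integral_le_of_norm_le_const (a := (0:ℝ)) (b := t)
    (f := fun τ => (1 / 2) * ‖Ξ τ - v‖ ^ 2) (C := (1 / 2) * (K * t) ^ 2) (by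
      intro s hs
      rw [Set.uIoc_of_le ht.le] at hs
      rw [Real.norm_of_nonneg (by positivity)]
      have := h2 s ⟨hs.1.le, hs.2⟩
      gcongr)
  refine hb.trans ?_
  rw [sub_zero, abs_of_pos ht]
  calc (1 / 2) * (K * t) ^ 2 * t = (1 / 2) * L ^ 2 * t ^ 3 * (1 + S) ^ 2 := by rw [hK]; ring
    _ ≤ (1 / 2) * L ^ 2 * t ^ 3 * (4 * (1 + ‖x‖ + ‖y‖)) ^ 2 := by gcongr
    _ = _ := by ring
end

section
/- (Refined action expansion.) Assume in addition that ‖∇V(z)‖ ≤ L(1 + ‖z‖) for all z. Then there are δ₀ > 0 and a constant C, depending only on M and L, such that: if 0 < t ≤ δ₀ and (x(·), ξ(·)) is a Hamiltonian trajectory with x(0) = y and x(t) = x, then the action S(t,x,y) := ∫₀ᵗ (½‖ξ(τ)‖² − V(x(τ))) dτ satisfies |S(t,x,y) − ‖x − y‖²/(2t) + ∫₀ᵗ V(y + (τ/t)(x − y)) dτ| ≤ C t³ (1 + ‖x‖² + ‖y‖²). -/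
open ContDiff

/-- Refined expansion of the classical action
`S(t,x,y) = ∫₀ᵗ (½‖ξ(τ)‖² − V(x(τ))) dτ`. -/
theorem stmt11 (M L : ℝ) (hM : 0 < M) (hL : 0 < L) :
    ∃ δ₀ > 0, ∃ C > 0, ∀ (d : ℕ), 1 ≤ d →
      ∀ V : EuclideanSpace ℝ (Fin d) → ℝ, ContDiff ℝ ∞ V →
      (∀ z, ‖iteratedFDeriv ℝ 2 V z‖ ≤ M) →
      (∀ z, ‖gradient V z‖ ≤ L * (1 + ‖z‖)) →
      ∀ t : ℝ, 0 < t → t ≤ δ₀ →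
      ∀ X Ξ : ℝ → EuclideanSpace ℝ (Fin d), IsHamTraj V X Ξ →
      ∀ x y : EuclideanSpace ℝ (Fin d), X 0 = y → X t = x →
        |(∫ τ in (0 : ℝ)..t, ((1 / 2) * ‖Ξ τ‖ ^ 2 - V (X τ)))
            - ‖x - y‖ ^ 2 / (2 * t)
            + ∫ τ in (0 : ℝ)..t, V (y + (τ / t) • (x - y))|
          ≤ C * t ^ 3 * (1 + ‖x‖ ^ 2 + ‖y‖ ^ 2) := by
  have hLL : (0:ℝ) < 1 + L := by linarith
  refine ⟨1 / (1 + L), by positivity, 18 * L ^ 2, by positivity, ?_⟩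
  intro d _ V hV _ hgrad t ht htd X Ξ hXΞ x y hX0 hXt
  obtain ⟨hX, hΞ⟩ := hXΞ
  have hXc : Continuous X := continuous_iff_continuousAt.2 fun s => (hX s).continuousAt
  have hΞc : Continuous Ξ := continuous_iff_continuousAt.2 fun s => (hΞ s).continuousAt
  have hVd : Differentiable ℝ V := hV.differentiable (by simp)
  have hVc : Continuous V := hV.continuous
  have htL : t ^ 2 * L ≤ 1 / 2 := by
    have h1 : t * (1 + L) ≤ 1 := (le_div_iff₀ hLL).1 htd
    have h2 : (t * (1 + L)) ^ 2 ≤ 1 := by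
      have : 0 ≤ t * (1 + L) := by positivity
      nlinarith
    nlinarith [mul_nonneg (sq_nonneg t) (sq_nonneg L), sq_nonneg t]
  obtain ⟨s0, hs0, hmax⟩ := (isCompact_Icc (a := (0:ℝ)) (b := t)).exists_isMaxOn
    (Set.nonempty_Icc.2 ht.le) (hXc.norm.continuousOn)
  set R := ‖X s0‖ with hR
  have hRle : ∀ s ∈ Set.Icc (0:ℝ) t, ‖X s‖ ≤ R := fun s hs => hmax hs
  have hR0 : 0 ≤ R := norm_nonneg _
  set G := L * (1 + R) with hG
  have hG0 : 0 ≤ G := by positivity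
  have hgG : ∀ z, ‖z‖ ≤ R → ‖gradient V z‖ ≤ G := fun z hz =>
    (hgrad z).trans (by rw [hG]; gcongr)
  have hmem0 : (0:ℝ) ∈ Set.Icc (0:ℝ) t := ⟨le_rfl, ht.le⟩
  have hmemt : t ∈ Set.Icc (0:ℝ) t := ⟨ht.le, le_rfl⟩
  have hΞs : ∀ s ∈ Set.Icc (0:ℝ) t, ∀ r ∈ Set.Icc (0:ℝ) t, ‖Ξ r - Ξ s‖ ≤ t * G := by
    intro s hs r hr
    have := (convex_Icc (0:ℝ) t).norm_image_sub_le_of_norm_hasDerivWithin_le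
      (f := Ξ) (C := G) (fun z hz => (hΞ z).hasDerivWithinAt)
      (fun z hz => by rw [norm_neg]; exact hgG _ (hRle z hz)) hs hr
    refine this.trans ?_
    rw [mul_comm]
    gcongr
    rw [Real.norm_eq_abs, abs_le]
    constructor <;> linarith [hs.1, hs.2, hr.1, hr.2]
  set v := (1 / t) • (x - y) with hv
  have htv : t • v = x - y := by rw [hv, smul_smul, mul_one_div_cancel ht.ne', one_smul]
  have hw' : ∀ s ∈ Set.Icc (0:ℝ) t, ‖Ξ s - v‖ ≤ t * G := by
    intro s hs
    have := (convex_Icc (0:ℝ) t).norm_image_sub_le_of_norm_hasDerivWithin_le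
      (f := fun r => X r - r • Ξ s) (f' := fun r => Ξ r - (1:ℝ) • Ξ s) (C := t * G)
      (fun z hz => ((hX z).sub ((hasDerivAt_id z).smul_const (Ξ s))).hasDerivWithinAt)
      (fun z hz => by rw [one_smul]; exact hΞs s hs z hz) hmem0 hmemt
    have e : (X t - t • Ξ s) - (X 0 - (0:ℝ) • Ξ s) = -(t • (Ξ s - v)) := by
      rw [hXt, hX0, smul_sub, htv, zero_smul]; abel
    simp only [e, norm_neg, norm_smul, sub_zero, Real.norm_eq_abs, abs_of_pos ht] at this
    rw [mul_comm] at this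
    exact le_of_mul_le_mul_right this ht
  have hw : ∀ s ∈ Set.Icc (0:ℝ) t, ‖X s - (y + s • v)‖ ≤ t ^ 2 * G := by
    intro s hs
    have := (convex_Icc (0:ℝ) t).norm_image_sub_le_of_norm_hasDerivWithin_le
      (f := fun r => X r - r • v) (f' := fun r => Ξ r - (1:ℝ) • v) (C := t * G)
      (fun z hz => ((hX z).sub ((hasDerivAt_id z).smul_const v)).hasDerivWithinAt)
      (fun z hz => by rw [one_smul]; exact hw' z hz) hmem0 hs
    have e : (X s - s • v) - (X 0 - (0:ℝ) • v) = X s - (y + s • v) := by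
      rw [hX0, zero_smul]; abel
    simp only [e, sub_zero, Real.norm_eq_abs, abs_of_nonneg hs.1] at this
    refine this.trans ?_
    have : t * G * s ≤ t * G * t := by gcongr; exact hs.2
    linarith
  have hell : ∀ s ∈ Set.Icc (0:ℝ) t, ‖y + s • v‖ ≤ ‖x‖ + ‖y‖ ∧ ‖y + s • v‖ ≤ R := by
    intro s hs
    have e : y + s • v = (1 - s / t) • y + (s / t) • x := by
      rw [hv, smul_smul, mul_one_div, smul_sub, sub_smul, one_smul]; abel
    have h0 : 0 ≤ s / t := div_nonneg hs.1 ht.le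
    have h1 : s / t ≤ 1 := (div_le_one ht).2 hs.2
    have hx : ‖x‖ ≤ R := hXt ▸ hRle t hmemt
    have hy : ‖y‖ ≤ R := hX0 ▸ hRle 0 hmem0
    have := norm_add_le ((1 - s / t) • y) ((s / t) • x)
    rw [norm_smul, norm_smul, Real.norm_eq_abs, Real.norm_eq_abs, abs_of_nonneg h0,
      abs_of_nonneg (by linarith : 0 ≤ 1 - s / t), ← e] at this
    constructor
    · nlinarith [norm_nonneg x, norm_nonneg y]
    · nlinarith [norm_nonneg x, norm_nonneg y]
  have hRb : R ≤ 2 * (‖x‖ + ‖y‖) + 1 := by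
    have h1 := hw s0 hs0
    have h2 := (hell s0 hs0).1
    have h3 : R ≤ ‖X s0 - (y + s0 • v)‖ + ‖y + s0 • v‖ := by
      rw [hR]; exact norm_le_norm_sub_add _ _
    have h4 : t ^ 2 * G ≤ 1 / 2 * (1 + R) := by
      rw [hG, ← mul_assoc]; gcongr
    linarith
  have hGb : G ≤ 2 * L * (1 + ‖x‖ + ‖y‖) := by
    rw [hG]; nlinarith
  have hVdiff : ∀ s ∈ Set.Icc (0:ℝ) t, |V (X s) - V (y + s • v)| ≤ t ^ 2 * G ^ 2 := by
    intro s hs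
    have := (convex_closedBall (0 : EuclideanSpace ℝ (Fin d)) R).norm_image_sub_le_of_norm_fderiv_le
      (𝕜 := ℝ) (f := V) (C := G) (fun z _ => hVd z)
      (fun z hz => by
        have := hgG z (by simpa using hz)
        rwa [gradient, LinearIsometryEquiv.norm_map] at this)
      (x := y + s • v) (y := X s) (by simpa using (hell s hs).2) (by simpa using hRle s hs)
    rw [Real.norm_eq_abs] at this
    nlinarith [mul_le_mul_of_nonneg_left (hw s hs) hG0]
  have hFTC : ∫ s in (0:ℝ)..t, (inner ℝ v (Ξ s) - 1 / 2 * ‖v‖ ^ 2) = ‖x - y‖ ^ 2 / (2 * t) := by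
    have := intervalIntegral.integral_eq_sub_of_hasDerivAt (a := 0) (b := t)
      (f := fun s => inner ℝ v (X s) - s * (1 / 2 * ‖v‖ ^ 2))
      (f' := fun s => inner ℝ v (Ξ s) - 1 / 2 * ‖v‖ ^ 2)
      (fun s _ => by
        have h1 := (innerSL ℝ v).hasFDerivAt.comp_hasDerivAt s (hX s)
        have h2 := (hasDerivAt_id s).mul_const (1 / 2 * ‖v‖ ^ 2)
        rw [one_mul] at h2
        exact h1.sub h2)
      ((by fun_prop : Continuous _).intervalIntegrable _ _)
    rw [this]
    have e : inner ℝ v (X t) - inner ℝ v (X 0) = t * ‖v‖ ^ 2 := by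
      rw [← inner_sub_right, hXt, hX0, ← htv, inner_smul_right, real_inner_self_eq_norm_sq]
    have e2 : ‖x - y‖ ^ 2 = t ^ 2 * ‖v‖ ^ 2 := by
      rw [← htv, norm_smul, mul_pow, Real.norm_eq_abs, sq_abs]
    rw [e2]
    field_simp
    linarith
  have hl : ∀ τ : ℝ, y + (τ / t) • (x - y) = y + τ • v := by
    intro τ; rw [hv, smul_smul, mul_one_div]
  simp only [hl]
  rw [← hFTC, ← intervalIntegral.integral_sub
    ((by fun_prop : Continuous _).intervalIntegrable _ _)
    ((by fun_prop : Continuous _).intervalIntegrable _ _),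
    ← intervalIntegral.integral_add
    ((by fun_prop : Continuous _).intervalIntegrable _ _)
    ((by fun_prop : Continuous _).intervalIntegrable _ _)]
  have hb := intervalIntegral.norm_integral_le_of_norm_le_const (a := (0:ℝ)) (b := t)
    (f := fun s => 1 / 2 * ‖Ξ s‖ ^ 2 - V (X s) - (inner ℝ v (Ξ s) - 1 / 2 * ‖v‖ ^ 2)
      + V (y + s • v)) (C := 3 / 2 * (t ^ 2 * G ^ 2)) (by
      intro s hs
      rw [Set.uIoc_of_le ht.le] at hs
      have hs' : s ∈ Set.Icc (0:ℝ) t := ⟨hs.1.le, hs.2⟩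
      have h1 := hVdiff s hs'
      have h2 := hw' s hs'
      have h3 : ‖Ξ s - v‖ ^ 2 ≤ t ^ 2 * G ^ 2 := by
        rw [← mul_pow]; gcongr
      have h4 := norm_sub_sq_real (Ξ s) v
      rw [real_inner_comm] at h4
      have h5 := sq_nonneg ‖Ξ s - v‖
      rw [abs_le] at h1
      rw [Real.norm_eq_abs, abs_le]
      constructor <;> linarith [h1.1, h1.2])
  rw [Real.norm_eq_abs, sub_zero, abs_of_pos ht] at hb
  refine hb.trans ?_
  have hG2 : G ^ 2 ≤ 12 * L ^ 2 * (1 + ‖x‖ ^ 2 + ‖y‖ ^ 2) := by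
    have h1 : G ^ 2 ≤ (2 * L * (1 + ‖x‖ + ‖y‖)) ^ 2 := by gcongr
    have h2 : (1 + ‖x‖ + ‖y‖) ^ 2 ≤ 3 * (1 + ‖x‖ ^ 2 + ‖y‖ ^ 2) := by
      nlinarith [sq_nonneg (‖x‖ - ‖y‖), sq_nonneg (‖x‖ - 1), sq_nonneg (‖y‖ - 1)]
    have h3 := mul_le_mul_of_nonneg_left h2 (by positivity : 0 ≤ 4 * L ^ 2)
    linarith
  have := mul_le_mul_of_nonneg_left hG2 (by positivity : 0 ≤ 3 / 2 * t ^ 3)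
  linarith
end

section
/- (Fujiwara's L² boundedness of oscillatory integral operators.) Let φ be a phase on ℝ^d × ℝ^d with inf_{x,y} |det D²ₓᵧφ(x,y)| ≥ δ > 0, and let a : ℝ^d × ℝ^d → ℂ be smooth with all derivatives up to order 2d+1 uniformly bounded. Then there is a constant C, depending only on d, δ, the uniform bounds on the derivatives of φ of order ≥ 2, and the bounds on the derivatives of a up to order 2d+1, such that for every λ ≥ 1 and every continuous compactly supported f : ℝ^d → ℂ, the function A(λ)f(x) = (λ/2π)^{d/2} ∫_{ℝ^d} e^{iλφ(x,y)} a(x,y) f(y) dy satisfies ‖A(λ)f‖_{L²(ℝ^d)} ≤ C ‖f‖_{L²(ℝ^d)}. -/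
open ContDiff MeasureTheory

/-- The matrix `D²ₓᵧφ(x,y)` of mixed second partial derivatives `∂²φ/∂xᵢ∂yⱼ`
of a function `φ` on `ℝ^d × ℝ^d`. -/
noncomputable def mixedHessian {d : ℕ}
    (φ : EuclideanSpace ℝ (Fin d) × EuclideanSpace ℝ (Fin d) → ℝ)
    (x y : EuclideanSpace ℝ (Fin d)) : Matrix (Fin d) (Fin d) ℝ :=
  Matrix.of fun i j =>
    fderiv ℝ (fun p => fderiv ℝ φ p (EuclideanSpace.single i 1, 0)) (x, y)
      (0, EuclideanSpace.single j 1)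

section
set_option linter.unusedSectionVars false
open scoped FourierTransform SchwartzMap


lemma fourier_flip {E : Type*} [NormedAddCommGroup E] [InnerProductSpace ℝ E] [FiniteDimensional ℝ E]
    [MeasurableSpace E] [BorelSpace E] (f g : E → ℂ) (hf : Integrable f) (hg : Integrable g) :
    ∫ x, (𝓕 f x) * g x = ∫ x, f x * 𝓕 g x := by
  have h := VectorFourier.integral_fourierIntegral_smul_eq_flip (μ := (volume : Measure E))
    (ν := (volume : Measure E)) (L := innerₗ E) (e := 𝐞) (f := f) (g := g)
    Real.continuous_fourierChar (by simpa using continuous_inner) hf hg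
  rw [flip_innerₗ] at h
  simp only [smul_eq_mul] at h
  exact h

lemma planch {E : Type*} [NormedAddCommGroup E] [InnerProductSpace ℝ E] [FiniteDimensional ℝ E]
    [MeasurableSpace E] [BorelSpace E] (h : E → ℂ) (hc : Continuous h) (hs : HasCompactSupport h) :
    ∫⁻ x, ‖𝓕 h x‖ₑ ^ 2 = ∫⁻ x, ‖h x‖ₑ ^ 2 := by
  have hm : MemLp h 2 volume := hc.memLp_of_hasCompactSupport hs
  have hi : Integrable h := hc.integrable_of_hasCompactSupport hs
  have hFc : Continuous (𝓕 h) := VectorFourier.fourierIntegral_continuous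
    Real.continuous_fourierChar (by simpa using continuous_inner) hi
  set H := hm.toLp h with hH
  have hae : ∀ᵐ x, (𝓕 H : Lp (α := E) ℂ 2 volume) x = 𝓕 h x := by
    apply ae_eq_of_integral_contDiff_smul_eq
    · exact (Lp.memLp _).locallyIntegrable (by norm_num)
    · exact hFc.locallyIntegrable
    · intro g hg hgs
      have hgs' : HasCompactSupport (fun x => (g x : ℂ)) := hgs.comp_left (g := fun t : ℝ => (t : ℂ)) (by simp)
      have hg' : ContDiff ℝ ∞ (fun x => (g x : ℂ)) := Complex.ofRealCLM.contDiff.comp hg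
      set G := hgs'.toSchwartzMap hg' with hG
      have e1 := congrArg (fun T => T G) (Lp.fourier_toTemperedDistribution_eq H)
      simp only [TemperedDistribution.fourier_apply, Lp.toTemperedDistribution_apply] at e1
      have e2 : ∫ x, g x • (𝓕 H : Lp (α := E) ℂ 2 volume) x = ∫ x, G x • (𝓕 H : Lp (α := E) ℂ 2 volume) x := by
        simp [hG]
      rw [e2, ← e1]
      have e3 : ∫ x, (𝓕 G) x • H x = ∫ x, 𝓕 (fun x => (g x : ℂ)) x * h x := by
        apply integral_congr_ae
        filter_upwards [hm.coeFn_toLp] with x hx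
        rw [hx, SchwartzMap.fourier_coe]
        simp [hG]
        left; rfl
      rw [e3, fourier_flip _ _ (hg'.continuous.integrable_of_hasCompactSupport hgs') hi]
      simp
  have key : eLpNorm (𝓕 h) 2 volume = eLpNorm h 2 volume := by
    rw [← eLpNorm_congr_ae hae, ← eLpNorm_congr_ae hm.coeFn_toLp]
    have := Lp.norm_fourier_eq H
    rw [Lp.norm_def, Lp.norm_def] at this
    exact (ENNReal.toReal_eq_toReal_iff' (Lp.eLpNorm_ne_top _) (Lp.eLpNorm_ne_top _)).1 this
  rw [eLpNorm_eq_lintegral_rpow_enorm_toReal (by norm_num) (by norm_num),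
    eLpNorm_eq_lintegral_rpow_enorm_toReal (by norm_num) (by norm_num)] at key
  have := congrArg (fun t : ENNReal => t ^ (2:ℝ)) key
  simp only [← ENNReal.rpow_mul] at this
  norm_num at this
  exact this


lemma newton {E : Type*} [NormedAddCommGroup E] [NormedSpace ℝ E] [FiniteDimensional ℝ E]
    (F : E → E) (A : E → E →L[ℝ] E) (hFc : Continuous F) (hA : Continuous A) (B c : ℝ) (hB : 0 < B) (hc : 0 < c)
    (hF : ∀ y v, ‖F (y + v) - F y - A y v‖ ≤ B * ‖v‖ ^ 2)
    (hAc : ∀ y v, c * ‖v‖ ≤ ‖A y v‖) :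
    (∀ p, ∃ z, F z = p) ∧ ∀ y y', c / 2 * ‖y - y'‖ ≤ ‖F y - F y'‖ := by
  -- inverse
  have hunit : ∀ y, IsUnit (A y) := by
    intro y
    have hinj : Function.Injective (A y) := by
      rw [injective_iff_map_eq_zero]
      intro v hv
      have := hAc y v
      rw [hv, norm_zero] at this
      have : ‖v‖ ≤ 0 := by
        by_contra hcon
        push Not at hcon
        nlinarith
      simpa using this
    let e := LinearEquiv.ofInjectiveEndo (A y : E →ₗ[ℝ] E) hinj
    refine ⟨⟨A y, e.symm.toContinuousLinearEquiv, ?_, ?_⟩, rfl⟩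
    · ext v; exact e.apply_symm_apply v
    · ext v; exact e.symm_apply_apply v
  let J : E → E →L[ℝ] E := fun y => Ring.inverse (A y)
  have hJc : Continuous J := by
    rw [continuous_iff_continuousAt]
    intro y
    obtain ⟨u, hu⟩ := hunit y
    have := NormedRing.inverse_continuousAt u
    rw [hu] at this
    exact ContinuousAt.comp (f := A) (g := Ring.inverse) this hA.continuousAt
  have hAJ : ∀ y w, A y (J y w) = w := by
    intro y w
    have := Ring.mul_inverse_cancel (A y) (hunit y)
    exact congrArg (fun T : E →L[ℝ] E => T w) this
  have hJn : ∀ y w, ‖J y w‖ ≤ c⁻¹ * ‖w‖ := by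
    intro y w
    have := hAc y (J y w)
    rw [hAJ] at this
    rw [inv_mul_eq_div, le_div_iff₀ hc]; linarith
  -- Newton iteration towards p
  obtain ⟨ε, hε0, hε1, hε⟩ : ∃ ε : ℝ, 0 < ε ∧ ε ≤ 1 ∧ B * c⁻¹ ^ 2 * ε ≤ 1 / 2 := by
    refine ⟨min 1 (1 / (2 * (B * c⁻¹ ^ 2))), by positivity, min_le_left _ _, ?_⟩
    have h0 : 0 < B * c⁻¹ ^ 2 := by positivity
    calc B * c⁻¹ ^ 2 * min 1 (1 / (2 * (B * c⁻¹ ^ 2))) ≤ B * c⁻¹ ^ 2 * (1 / (2 * (B * c⁻¹ ^ 2))) := by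
          gcongr; exact min_le_right _ _
      _ = 1 / 2 := by field_simp
  have main : ∀ p, ∃ L : E → E, Continuous L ∧ (∀ y, F (L y) = p) ∧
      ∀ y, ‖L y - y‖ ≤ 2 * c⁻¹ * ‖F y - p‖ := by
    intro p
    let r : E → ℝ := fun y => ‖F y - p‖
    let h : E → ℝ := fun y => ε / (1 + r y)
    have hr : ∀ y, 0 ≤ r y := fun y => norm_nonneg _
    have hrc : Continuous r := (hFc.sub continuous_const).norm
    have hhc : Continuous h := continuous_const.div (continuous_const.add hrc)
      (fun y => by have := hr y; positivity)
    have hh0 : ∀ y, 0 < h y := fun y => by have := hr y; positivity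
    have hh1 : ∀ y, h y ≤ 1 := fun y => by
      have := hr y
      rw [div_le_one (by positivity)]; linarith
    have hhr : ∀ y, h y * r y ≤ ε := fun y => by
      have := hr y
      simp only [h]
      rw [div_mul_eq_mul_div, div_le_iff₀ (by positivity)]
      nlinarith
    let N : E → E := fun y => y - h y • J y (F y - p)
    have hNc : Continuous N := continuous_id.sub (hhc.smul (hJc.clm_apply (hFc.sub continuous_const)))
    have hstep : ∀ y, ‖N y - y‖ ≤ c⁻¹ * (h y * r y) := by
      intro y
      have : N y - y = - (h y • J y (F y - p)) := by simp [N]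
      rw [this, norm_neg, norm_smul, Real.norm_of_nonneg (hh0 y).le]
      calc h y * ‖J y (F y - p)‖ ≤ h y * (c⁻¹ * r y) := by
            gcongr
            exact hJn _ _
        _ = _ := by ring
    have hdec : ∀ y, r (N y) ≤ r y - h y * r y / 2 := by
      intro y
      have e : N y = y + (-(h y • J y (F y - p))) := by simp [N, sub_eq_add_neg]
      have h1 := hF y (-(h y • J y (F y - p)))
      rw [← e, map_neg, map_smul, hAJ] at h1
      have h2 : ‖-(h y • J y (F y - p))‖ ≤ c⁻¹ * (h y * r y) := by
        have := hstep y
        rwa [e, add_sub_cancel_left] at this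
      have h3 : F (N y) - p = (F (N y) - F y - -(h y • (F y - p))) + (1 - h y) • (F y - p) := by
        rw [sub_smul, one_smul]; abel
      have h4 : r (N y) ≤ B * ‖-(h y • J y (F y - p))‖ ^ 2 + (1 - h y) * r y := by
        calc r (N y) = ‖F (N y) - p‖ := rfl
          _ ≤ _ := by
            rw [h3]
            refine (norm_add_le _ _).trans (add_le_add h1 ?_)
            rw [norm_smul, Real.norm_of_nonneg (by linarith [hh1 y])]
      have h5 : B * ‖-(h y • J y (F y - p))‖ ^ 2 ≤ h y * r y / 2 := by
        have hq : 0 ≤ h y * r y := mul_nonneg (hh0 y).le (hr y)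
        calc B * ‖-(h y • J y (F y - p))‖ ^ 2 ≤ B * (c⁻¹ * (h y * r y)) ^ 2 := by gcongr
          _ = (B * c⁻¹ ^ 2 * (h y * r y)) * (h y * r y) := by ring
          _ ≤ (B * c⁻¹ ^ 2 * ε) * (h y * r y) := by
              gcongr; exact hhr y
          _ ≤ 1 / 2 * (h y * r y) := by gcongr
          _ = _ := by ring
      nlinarith
    have hstep2 : ∀ y, ‖N y - y‖ ≤ 2 * c⁻¹ * (r y - r (N y)) := by
      intro y
      refine (hstep y).trans ?_
      have := hdec y
      have : h y * r y ≤ 2 * (r y - r (N y)) := by linarith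
      calc _ ≤ c⁻¹ * (2 * (r y - r (N y))) := by gcongr
        _ = _ := by ring
    have hmono : ∀ y, r (N y) ≤ r y := fun y => by
      have := hdec y
      have := mul_nonneg (hh0 y).le (hr y)
      linarith
    have hiter_le : ∀ y n, r (N^[n] y) ≤ r y := by
      intro y n
      induction n with
      | zero => simp
      | succ n ih => rw [Function.iterate_succ_apply']; exact (hmono _).trans ih
    have hgeo : ∀ y n, r (N^[n] y) ≤ (1 - h y / 2) ^ n * r y := by
      intro y n
      induction n with
      | zero => simp
      | succ n ih =>
        rw [Function.iterate_succ_apply', pow_succ]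
        have hle : h y ≤ h (N^[n] y) := by
          simp only [h]
          have := hiter_le y n
          have := hr (N^[n] y)
          gcongr
        have h1 := hdec (N^[n] y)
        have h2 := hr (N^[n] y)
        have h3 : r (N (N^[n] y)) ≤ (1 - h y / 2) * r (N^[n] y) := by nlinarith
        refine h3.trans ?_
        have h4 := hh1 y
        calc (1 - h y / 2) * r (N^[n] y) ≤ (1 - h y / 2) * ((1 - h y / 2) ^ n * r y) := by
              gcongr; linarith
          _ = _ := by ring
    have hdist : ∀ y n m, ‖N^[n + m] y - N^[n] y‖ ≤ 2 * c⁻¹ * (r (N^[n] y) - r (N^[n + m] y)) := by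
      intro y n m
      induction m with
      | zero => simp
      | succ m ih =>
        rw [← add_assoc, Function.iterate_succ_apply']
        have h1 := hstep2 (N^[n + m] y)
        calc _ ≤ ‖N (N^[n + m] y) - N^[n + m] y‖ + ‖N^[n + m] y - N^[n] y‖ := by
              have := norm_add_le (N (N^[n + m] y) - N^[n + m] y) (N^[n + m] y - N^[n] y)
              simpa using this
          _ ≤ _ := by linarith
    have hr0 : ∀ y, Filter.Tendsto (fun n => r (N^[n] y)) Filter.atTop (nhds 0) := by
      intro y
      refine squeeze_zero (fun n => hr _) (hgeo y) ?_
      have := (tendsto_pow_atTop_nhds_zero_of_lt_one (r := 1 - h y / 2) (by linarith [hh1 y])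
        (by linarith [hh0 y])).mul_const (r y)
      simpa using this
    have hlim : ∀ y, ∃ l, Filter.Tendsto (fun n => N^[n] y) Filter.atTop (nhds l) := by
      intro y
      apply cauchySeq_tendsto_of_complete
      have : FiniteDimensional ℝ E := inferInstance
      refine cauchySeq_of_le_tendsto_0' (fun n => 2 * c⁻¹ * r (N^[n] y)) ?_ ?_
      · intro n m hnm
        obtain ⟨k, rfl⟩ := Nat.exists_eq_add_of_le hnm
        rw [dist_comm, dist_eq_norm]
        refine (hdist y n k).trans ?_
        gcongr
        linarith [hr (N^[n + k] y)]
      · simpa using (hr0 y).const_mul (2 * c⁻¹)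
    choose L hL using hlim
    have hLd : ∀ y n, ‖L y - N^[n] y‖ ≤ 2 * c⁻¹ * r (N^[n] y) := by
      intro y n
      have t1 : Filter.Tendsto (fun m => ‖N^[n + m] y - N^[n] y‖) Filter.atTop (nhds ‖L y - N^[n] y‖) := by
        have := (hL y).comp (Filter.tendsto_add_atTop_nat n)
        simp only [Function.comp_def] at this
        refine (Filter.Tendsto.sub_const ?_ _).norm
        simpa [add_comm] using this
      refine le_of_tendsto' t1 (fun m => (hdist y n m).trans ?_)
      gcongr
      linarith [hr (N^[n + m] y)]
    refine ⟨L, ?_, ?_, ?_⟩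
    · -- locally uniform limit
      have : TendstoLocallyUniformly (fun n y => N^[n] y) L Filter.atTop := by
        rw [Metric.tendstoLocallyUniformly_iff]
        intro e he y
        -- nearby points: r < r y + 1
        let R := r y + 1
        let q := ε / (1 + R)
        have hR : 0 < R := by have := hr y; positivity
        have hq : 0 < q := by positivity
        have hq1 : q ≤ 1 := by
          simp only [q]; rw [div_le_one (by positivity)]; linarith
        refine ⟨{z | r z < R}, (isOpen_lt hrc continuous_const).mem_nhds (by simp [R]), ?_⟩
        have : Filter.Tendsto (fun n : ℕ => 2 * c⁻¹ * ((1 - q / 2) ^ n * R)) Filter.atTop (nhds 0) := by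
          have := ((tendsto_pow_atTop_nhds_zero_of_lt_one (r := 1 - q / 2) (by linarith)
            (by linarith)).mul_const R).const_mul (2 * c⁻¹)
          simpa using this
        filter_upwards [this.eventually_lt_const he] with n hn z hz
        rw [dist_eq_norm]
        refine ((hLd z n).trans ?_).trans_lt hn
        gcongr
        refine (hgeo z n).trans ?_
        have hz' : r z < R := hz
        have hqz : q ≤ h z := by
          simp only [q, h]
          have := hr z
          gcongr
        have := hh1 z
        have := hr z
        exact mul_le_mul (pow_le_pow_left₀ (by linarith) (by linarith) n) hz'.le (hr z)
          (pow_nonneg (by linarith) n)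
      exact this.continuous (Filter.Frequently.of_forall fun n => hNc.iterate n)
    · intro y
      have t1 : Filter.Tendsto (fun n => r (N^[n] y)) Filter.atTop (nhds (r (L y))) :=
        (hrc.tendsto _).comp (hL y)
      have := tendsto_nhds_unique t1 (hr0 y)
      simp only [r] at this
      exact sub_eq_zero.1 (norm_eq_zero.1 this)
    · intro y
      simpa using hLd y 0
  refine ⟨fun p => ?_, fun y y' => ?_⟩
  · obtain ⟨L, -, h, -⟩ := main p
    exact ⟨_, h 0⟩
  · obtain ⟨L, hLc, hL, hLd⟩ := main (F y')
    have hsep : ∀ z w, F z = F w → ‖w - z‖ < c / B → z = w := by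
      intro z w hzw hlt
      have h1 := hF z (w - z)
      rw [add_sub_cancel, hzw, sub_self, zero_sub, norm_neg] at h1
      have h2 := hAc z (w - z)
      rw [lt_div_iff₀ hB] at hlt
      have : ‖w - z‖ ≤ 0 := by
        by_contra hcon
        push Not at hcon
        nlinarith
      have := norm_le_zero_iff.1 this
      exact (sub_eq_zero.1 this).symm
    have hloc : IsLocallyConstant L := by
      rw [IsLocallyConstant.iff_eventually_eq]
      intro x
      have := (Metric.continuous_iff'.1 hLc) x (c / B) (by positivity)
      filter_upwards [this] with z hz
      rw [dist_comm, dist_eq_norm] at hz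
      exact hsep _ _ (by rw [hL, hL]) hz
    have e1 : L y = L y' := hloc.apply_eq_of_isPreconnected isPreconnected_univ trivial trivial
    have e2 : L y' = y' := by
      have := hLd y'
      simp only [sub_self, norm_zero, mul_zero] at this
      exact sub_eq_zero.1 (norm_le_zero_iff.1 this)
    have := hLd y
    rw [e1, e2, norm_sub_rev] at this
    have h2 : c / 2 * (2 * c⁻¹ * ‖F y - F y'‖) = ‖F y - F y'‖ := by field_simp
    rw [← h2]
    gcongr


lemma schur_test {X Z : Type*} [MeasurableSpace X] [MeasurableSpace Z] (μ : Measure X) (ν : Measure Z)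
    [SFinite μ] [SFinite ν]
    (K : X → Z → ENNReal) (hK : Measurable (Function.uncurry K)) (V : Z → ENNReal) (hV : Measurable V)
    (W : X → ENNReal) (hW : ∀ x, W x ≤ ∫⁻ z, K x z * V z ∂ν) (C1 C2 : ENNReal)
    (h1 : ∀ x, ∫⁻ z, K x z ∂ν ≤ C1) (h2 : ∀ z, ∫⁻ x, K x z ∂μ ≤ C2) :
    ∫⁻ x, W x ^ 2 ∂μ ≤ C1 * C2 * ∫⁻ z, V z ^ 2 ∂ν := by
  have hKx : ∀ x, Measurable (K x) := fun x => hK.of_uncurry_left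
  have hKz : ∀ z, Measurable (fun x => K x z) := fun x => hK.of_uncurry_right
  have cs : ∀ x, W x ^ 2 ≤ C1 * ∫⁻ z, K x z * V z ^ 2 ∂ν := by
    intro x
    have hh := ENNReal.lintegral_mul_le_Lp_mul_Lq ν (p := 2) (q := 2) Real.HolderConjugate.two_two
      (f := fun z => K x z ^ (1/2 : ℝ)) (g := fun z => K x z ^ (1/2 : ℝ) * V z)
      ((hKx x).pow_const _).aemeasurable (((hKx x).pow_const _).mul hV).aemeasurable
    have e0 : ∀ t : ENNReal, t ^ (1/2:ℝ) * t ^ (1/2:ℝ) = t := by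
      intro t
      rw [← ENNReal.rpow_add_of_nonneg _ _ (by norm_num) (by norm_num)]; norm_num
    have e1 : ∀ t : ENNReal, (t ^ (1/2:ℝ)) ^ (2:ℝ) = t := by
      intro t; rw [← ENNReal.rpow_mul]; norm_num
    simp only [Pi.mul_apply, ← mul_assoc, e0, ENNReal.mul_rpow_of_nonneg _ _ (show (0:ℝ) ≤ 2 by norm_num), e1] at hh
    calc W x ^ 2 ≤ ((∫⁻ z, K x z ∂ν) ^ (1/2:ℝ) * (∫⁻ z, K x z * V z ^ (2:ℝ) ∂ν) ^ (1/2:ℝ)) ^ 2 := by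
          gcongr; exact (hW x).trans hh
      _ = (∫⁻ z, K x z ∂ν) * (∫⁻ z, K x z * V z ^ 2 ∂ν) := by
          rw [mul_pow, pow_two, pow_two, e0, e0]; simp
      _ ≤ _ := by gcongr; exact h1 x
  calc ∫⁻ x, W x ^ 2 ∂μ ≤ ∫⁻ x, C1 * ∫⁻ z, K x z * V z ^ 2 ∂ν ∂μ := lintegral_mono cs
    _ = C1 * ∫⁻ x, ∫⁻ z, K x z * V z ^ 2 ∂ν ∂μ := by
        rw [lintegral_const_mul]
        exact Measurable.lintegral_prod_right' (f := fun p : X × Z => K p.1 p.2 * V p.2 ^ 2)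
          (hK.mul ((hV.comp measurable_snd).pow_const 2))
    _ = C1 * ∫⁻ z, ∫⁻ x, K x z * V z ^ 2 ∂μ ∂ν := by
        rw [lintegral_lintegral_swap]
        exact (hK.mul ((hV.comp measurable_snd).pow_const 2)).aemeasurable
    _ = C1 * ∫⁻ z, (∫⁻ x, K x z ∂μ) * V z ^ 2 ∂ν := by
        congr 1; apply lintegral_congr; intro z
        rw [lintegral_mul_const _ (hKz z)]
    _ ≤ C1 * ∫⁻ z, C2 * V z ^ 2 ∂ν := by
        gcongr with z; exact h2 z
    _ = _ := by rw [lintegral_const_mul _ (hV.pow_const 2), mul_assoc]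


section
variable {E : Type*} [NormedAddCommGroup E] [InnerProductSpace ℝ E] [FiniteDimensional ℝ E]
    [MeasurableSpace E] [BorelSpace E]

lemma fdecay (N : ℕ) (hN : 0 < N) (Cb : ℝ) : ∃ C : ℝ, 0 ≤ C ∧ ∀ b : E × E → ℂ, ContDiff ℝ ∞ b →
    tsupport b ⊆ Metric.closedBall 0 1 → (∀ n ≤ N, ∀ q, ‖iteratedFDeriv ℝ n b q‖ ≤ Cb) →
    ∀ ξ η : E, ‖∫ q : E × E, Complex.exp (-(2 * Real.pi * Complex.I * (inner ℝ q.1 ξ + inner ℝ q.2 η : ℝ))) * b q‖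
      ≤ C * ((1 + ‖ξ‖) ^ (-((N:ℝ)/2)) * (1 + ‖η‖) ^ (-((N:ℝ)/2))) := by
  by_cases hCb : 0 ≤ Cb
  swap
  · refine ⟨0, le_rfl, fun b _ _ h => ?_⟩
    exact absurd ((norm_nonneg _).trans (h 0 (Nat.zero_le _) 0)) hCb
  set vol := (volume (Metric.closedBall (0 : E × E) 1)).toReal with hvol
  refine ⟨2 ^ N * (Cb * vol + Cb * vol), by positivity, ?_⟩
  intro b hb hbs hbd ξ η
  have hcs : HasCompactSupport b := HasCompactSupport.of_support_subset_isCompact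
    (isCompact_closedBall (0 : E × E) 1) ((subset_tsupport b).trans hbs)
  have hint : ∀ n : ℕ, Integrable (iteratedFDeriv ℝ n b) := fun n =>
    (hb.continuous_iteratedFDeriv (by exact_mod_cast le_top)).integrable_of_hasCompactSupport (hcs.iteratedFDeriv n)
  have hI : ∀ n ≤ N, ∫ q, ‖iteratedFDeriv ℝ n b q‖ ≤ Cb * vol := by
    intro n hn
    have h0 : ∀ q, q ∉ Metric.closedBall (0 : E × E) 1 → ‖iteratedFDeriv ℝ n b q‖ = 0 := by
      intro q hq
      rw [norm_eq_zero]
      by_contra hne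
      exact hq (hbs (support_iteratedFDeriv_subset n hne))
    rw [← setIntegral_eq_integral_of_forall_compl_eq_zero h0]
    have := norm_setIntegral_le_of_norm_le_const (f := fun q => ‖iteratedFDeriv ℝ n b q‖) (C := Cb)
      (s := Metric.closedBall (0 : E × E) 1) (μ := volume)
      (isCompact_closedBall (0 : E × E) 1).measure_lt_top (fun x _ => by simpa using hbd n hn x)
    exact (le_abs_self _).trans this
  let L : (E × E) →L[ℝ] (E × E) →L[ℝ] ℝ :=
    (innerSL ℝ).bilinearComp (ContinuousLinearMap.fst ℝ E E) (ContinuousLinearMap.fst ℝ E E) +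
    (innerSL ℝ).bilinearComp (ContinuousLinearMap.snd ℝ E E) (ContinuousLinearMap.snd ℝ E E)
  have hL : ∀ p q, L p q = inner ℝ p.1 q.1 + inner ℝ p.2 q.2 := fun p q => by simp [L]
  set M := ∫ q : E × E, Complex.exp (-(2 * Real.pi * Complex.I * (inner ℝ q.1 ξ + inner ℝ q.2 η : ℝ))) * b q with hM
  have hMF : VectorFourier.fourierIntegral 𝐞 volume L.toLinearMap₁₂ b (ξ, η) = M := by
    rw [VectorFourier.fourierIntegral, hM]
    congr 1
    ext q
    rw [Circle.smul_def, Real.fourierChar_apply, smul_eq_mul]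
    congr 2
    have : L.toLinearMap₁₂ q (ξ, η) = inner ℝ q.1 ξ + inner ℝ q.2 η := hL q (ξ, η)
    rw [this]
    push_cast; ring
  have hM0 : ‖M‖ ≤ Cb * vol := by
    rw [← hMF]
    refine (VectorFourier.norm_fourierIntegral_le_integral_norm _ _ _ _ _).trans ?_
    have := hI 0 (Nat.zero_le _)
    simpa using this
  have key : ∀ m : E × E, |L m (ξ, η)| ^ N * ‖M‖ ≤ ‖m‖ ^ N * (Cb * vol) := by
    intro m
    have : (volume : Measure (E × E)).IsAddHaarMeasure := by
      rw [Measure.volume_eq_prod]; infer_instance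
    have h1 := congrFun (VectorFourier.fourierIntegral_iteratedFDeriv L (N := ⊤) (f := b) (μ := volume) hb (fun n _ => hint n)
      (n := N) le_top) (ξ, η)
    have h2 := congrArg (fun T : ContinuousMultilinearMap ℝ (fun _ : Fin N => E × E) ℂ => ‖T (fun _ => m)‖) h1
    simp only [VectorFourier.fourierPowSMulRight_apply, hMF] at h2
    have h3 : ‖(VectorFourier.fourierIntegral 𝐞 volume L.toLinearMap₁₂ (iteratedFDeriv ℝ N b) (ξ, η)) (fun _ => m)‖
        ≤ ‖m‖ ^ N * (Cb * vol) := by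
      refine (ContinuousMultilinearMap.le_opNorm _ _).trans ?_
      rw [Finset.prod_const, Finset.card_univ, Fintype.card_fin, mul_comm]
      gcongr
      exact (VectorFourier.norm_fourierIntegral_le_integral_norm _ _ _ _ _).trans (hI N le_rfl)
    rw [h2] at h3
    refine le_trans ?_ h3
    simp only [norm_smul, norm_pow, norm_neg, Finset.prod_const, Finset.card_univ, Fintype.card_fin,
      neg_apply, ContinuousLinearMap.flip_apply, norm_mul, Complex.norm_I, mul_one, Real.norm_eq_abs]
    have : (1:ℝ) ≤ ‖(2:ℂ)‖ * ‖(Real.pi : ℂ)‖ := by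
      simp [abs_of_pos Real.pi_pos]; nlinarith [Real.pi_gt_three]
    have h5 := one_le_pow₀ (n := N) this
    have h6 : 0 ≤ |L m (ξ, η)| ^ N * ‖M‖ := by positivity
    nlinarith
  have kx : ‖ξ‖ ^ N * ‖M‖ ≤ Cb * vol := by
    by_cases h : ξ = 0
    · subst h; rw [norm_zero, zero_pow hN.ne']; simp; positivity
    have h1 := key (ξ, 0)
    have h2 : 0 < ‖ξ‖ ^ N := by positivity
    rw [hL] at h1
    simp only [inner_zero_left, add_zero, real_inner_self_eq_norm_sq, Prod.norm_mk, norm_zero,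
      max_eq_left (norm_nonneg ξ), abs_of_nonneg (sq_nonneg ‖ξ‖)] at h1
    have h3 : (‖ξ‖ ^ 2) ^ N = ‖ξ‖ ^ N * ‖ξ‖ ^ N := by ring
    rw [h3, mul_assoc] at h1
    exact le_of_mul_le_mul_left h1 h2
  have ky : ‖η‖ ^ N * ‖M‖ ≤ Cb * vol := by
    by_cases h : η = 0
    · subst h; rw [norm_zero, zero_pow hN.ne']; simp; positivity
    have h1 := key (0, η)
    have h2 : 0 < ‖η‖ ^ N := by positivity
    rw [hL] at h1
    simp only [inner_zero_left, zero_add, real_inner_self_eq_norm_sq, Prod.norm_mk, norm_zero,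
      max_eq_right (norm_nonneg η), abs_of_nonneg (sq_nonneg ‖η‖)] at h1
    have h3 : (‖η‖ ^ 2) ^ N = ‖η‖ ^ N * ‖η‖ ^ N := by ring
    rw [h3, mul_assoc] at h1
    exact le_of_mul_le_mul_left h1 h2
  set t := max ‖ξ‖ ‖η‖ with ht
  have ht0 : 0 ≤ t := le_max_of_le_left (norm_nonneg _)
  have kt : t ^ N * ‖M‖ ≤ Cb * vol := by
    rcases max_choice ‖ξ‖ ‖η‖ with h | h <;> rw [ht, h] <;> assumption
  have kt2 : (1 + t) ^ N * ‖M‖ ≤ 2 ^ N * (Cb * vol + Cb * vol) := by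
    have h1 : (1 + t) ^ N ≤ 2 ^ N * (1 + t ^ N) := by
      rcases le_total t 1 with h | h
      · calc (1 + t) ^ N ≤ 2 ^ N := by gcongr; linarith
          _ ≤ _ := by nlinarith [pow_nonneg ht0 N, pow_pos (show (0:ℝ) < 2 by norm_num) N]
      · calc (1 + t) ^ N ≤ (2 * t) ^ N := by gcongr; linarith
          _ = 2 ^ N * t ^ N := mul_pow _ _ _
          _ ≤ _ := by nlinarith [pow_nonneg ht0 N, pow_pos (show (0:ℝ) < 2 by norm_num) N]
    calc (1 + t) ^ N * ‖M‖ ≤ 2 ^ N * (1 + t ^ N) * ‖M‖ := by gcongr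
      _ = 2 ^ N * (‖M‖ + t ^ N * ‖M‖) := by ring
      _ ≤ _ := by gcongr
  have hle : (1 + ‖ξ‖) ^ ((N:ℝ)/2) * (1 + ‖η‖) ^ ((N:ℝ)/2) ≤ (1 + t) ^ N := by
    calc _ ≤ (1 + t) ^ ((N:ℝ)/2) * (1 + t) ^ ((N:ℝ)/2) := by
          gcongr
          · exact le_max_left _ _
          · exact le_max_right _ _
      _ = (1 + t) ^ N := by
          rw [← Real.rpow_add (by positivity), add_halves, Real.rpow_natCast]
  rw [Real.rpow_neg (by positivity), Real.rpow_neg (by positivity), ← mul_inv, ← div_eq_mul_inv,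
    le_div_iff₀ (by positivity), mul_comm]
  refine le_trans ?_ kt2
  gcongr
end


section
variable {P : Type*} [NormedAddCommGroup P] [NormedSpace ℝ P]

lemma iter_mul_bound (N : ℕ) (f g : P → ℂ) (hf : ContDiff ℝ ∞ f) (hg : ContDiff ℝ ∞ g) (x : P)
    (A B : ℝ) (hA : ∀ n ≤ N, ‖iteratedFDeriv ℝ n f x‖ ≤ A) (hB : ∀ n ≤ N, ‖iteratedFDeriv ℝ n g x‖ ≤ B) :
    ∀ n ≤ N, ‖iteratedFDeriv ℝ n (fun y => f y * g y) x‖ ≤ 2 ^ N * A * B := by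
  intro n hn
  have hA0 : 0 ≤ A := (norm_nonneg _).trans (hA 0 (Nat.zero_le _))
  have hB0 : 0 ≤ B := (norm_nonneg _).trans (hB 0 (Nat.zero_le _))
  refine (norm_iteratedFDeriv_mul_le hf hg x (n := n) (by exact_mod_cast le_top)).trans ?_
  calc _ ≤ ∑ i ∈ Finset.range (n + 1), (n.choose i : ℝ) * (A * B) := by
        apply Finset.sum_le_sum
        intro i hi
        have hi' := Finset.mem_range_succ_iff.1 hi
        rw [mul_assoc]
        gcongr
        · exact hA i (hi'.trans hn)
        · exact hB _ (by omega)
    _ = 2 ^ n * (A * B) := by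
        rw [← Finset.sum_mul]
        congr 1
        exact_mod_cast Nat.sum_range_choose n
    _ ≤ 2 ^ N * (A * B) := by
        gcongr
        norm_num
    _ = _ := by ring

lemma taylor1 (φ : P → ℝ) (hφ : ContDiff ℝ ∞ φ) (B2 : ℝ) (h2 : ∀ p, ‖iteratedFDeriv ℝ 2 φ p‖ ≤ B2) (p q : P) :
    ‖fderiv ℝ φ q - fderiv ℝ φ p‖ ≤ B2 * ‖q - p‖ := by
  apply Convex.norm_image_sub_le_of_norm_fderiv_le (𝕜 := ℝ) (s := Set.univ)
  · intro x _
    exact ((hφ.fderiv_right (m := ∞) (by simp)).differentiable (by simp)).differentiableAt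
  · intro x _
    have := h2 x
    rwa [show 2 = 1 + 1 from rfl, ← norm_iteratedFDeriv_fderiv, norm_iteratedFDeriv_one] at this
  · exact convex_univ
  · trivial
  · trivial

lemma amp_bound (N : ℕ) (B : ℕ → ℝ) (G : P → ℂ) (hG : ContDiff ℝ ∞ G)
    (hGs : tsupport G ⊆ Metric.closedBall 0 1) (BG : ℝ) (hGB : ∀ n ≤ N, ∀ q, ‖iteratedFDeriv ℝ n G q‖ ≤ BG) :
    ∃ C : ℝ, ∀ (φ : P → ℝ) (a : P → ℂ), ContDiff ℝ ∞ φ →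
      (∀ k : ℕ, 2 ≤ k → ∀ p, ‖iteratedFDeriv ℝ k φ p‖ ≤ B k) →
      ContDiff ℝ ∞ a → (∀ k : ℕ, k ≤ N → ∀ p, ‖iteratedFDeriv ℝ k a p‖ ≤ B k) →
      ∀ p0 : P, 
        ContDiff ℝ ∞ (fun q => Complex.exp (Complex.I * (φ (p0 + q) - φ p0 - fderiv ℝ φ p0 q : ℝ)) * a (p0 + q) * G q) ∧
        tsupport (fun q => Complex.exp (Complex.I * (φ (p0 + q) - φ p0 - fderiv ℝ φ p0 q : ℝ)) * a (p0 + q) * G q) ⊆ Metric.closedBall 0 1 ∧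
        ∀ n ≤ N, ∀ q, ‖iteratedFDeriv ℝ n (fun q => Complex.exp (Complex.I * (φ (p0 + q) - φ p0 - fderiv ℝ φ p0 q : ℝ)) * a (p0 + q) * G q) q‖ ≤ C := by
  let D : ℝ := 1 + ∑ k ∈ Finset.range (N + 3), |B k|
  have hD1 : 1 ≤ D := by
    have : 0 ≤ ∑ k ∈ Finset.range (N + 3), |B k| := Finset.sum_nonneg (fun _ _ => abs_nonneg _)
    simp only [D]; linarith
  have hBD : ∀ k, k < N + 3 → B k ≤ D := by
    intro k hk
    have := Finset.single_le_sum (f := fun k => |B k|) (fun _ _ => abs_nonneg _) (Finset.mem_range.2 hk)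
    have h2 := le_abs_self (B k)
    simp only [D]; linarith
  refine ⟨2 ^ N * (2 ^ N * ((N.factorial : ℝ) * 1 * D ^ N) * D) * BG, ?_⟩
  intro φ a hφ hφB ha haB p0
  set R : P → ℝ := fun q => φ (p0 + q) - φ p0 - fderiv ℝ φ p0 q with hR
  have hRs : ContDiff ℝ ∞ R := by
    refine ((hφ.comp (contDiff_const.add contDiff_id)).sub contDiff_const).sub (fderiv ℝ φ p0).contDiff
  let ee : ℝ → ℂ := fun t => Complex.exp (Complex.I * t)
  have hee : ContDiff ℝ ∞ ee := by
    simp only [ee]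
    exact (contDiff_const.mul Complex.ofRealCLM.contDiff).cexp
  have hee_b : ∀ i t, ‖iteratedFDeriv ℝ i ee t‖ ≤ 1 := by
    intro i t
    rw [norm_iteratedFDeriv_eq_norm_iteratedDeriv]
    have : ∀ i, iteratedDeriv i ee = fun t => Complex.I ^ i * ee t := by
      intro i
      induction i with
      | zero => simp
      | succ i ih =>
        rw [iteratedDeriv_succ, ih]
        ext t
        have h1 : HasDerivAt ee (Complex.exp (Complex.I * t) * (Complex.I * 1)) t := by
          apply HasDerivAt.cexp
          exact (Complex.ofRealCLM.hasDerivAt (x := t)).const_mul Complex.I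
        rw [(h1.const_mul (Complex.I ^ i)).deriv]
        simp only [ee]; ring
    rw [this]
    simp [ee, Complex.norm_exp_I_mul_ofReal]
  have hfd : ∀ q, fderiv ℝ R q = fderiv ℝ φ (p0 + q) - fderiv ℝ φ p0 := by
    intro q
    have h1 : HasFDerivAt (fun q => φ (p0 + q)) (fderiv ℝ φ (p0 + q)) q := by
      have := ((hφ.differentiable (by simp)) (p0 + q)).hasFDerivAt
      rw [hasFDerivAt_comp_add_left]
      exact this
    exact ((h1.sub_const _).sub (fderiv ℝ φ p0).hasFDerivAt).fderiv
  have hRb : ∀ q, q ∈ Metric.closedBall (0:P) 1 → ∀ i, 1 ≤ i → i ≤ N → ‖iteratedFDeriv ℝ i R q‖ ≤ D ^ i := by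
    intro q hq i hi1 hiN
    refine le_trans ?_ (le_self_pow₀ hD1 (by omega))
    have hq' : ‖q‖ ≤ 1 := by simpa using hq
    rcases Nat.lt_or_ge i 2 with h | h
    · obtain rfl : i = 1 := by omega
      rw [norm_iteratedFDeriv_one, hfd]
      have h3 := taylor1 φ hφ (B 2) (hφB 2 le_rfl) p0 (p0 + q)
      rw [add_sub_cancel_left] at h3
      have h4 := hBD 2 (by omega)
      have h5 : 0 ≤ B 2 := (norm_nonneg _).trans (hφB 2 le_rfl 0)
      nlinarith
    · obtain ⟨j, rfl⟩ : ∃ j, i = j + 1 := ⟨i - 1, by omega⟩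
      rw [← norm_iteratedFDeriv_fderiv]
      have e1 : fderiv ℝ R = fun q => fderiv ℝ φ (p0 + q) - fderiv ℝ φ p0 := funext hfd
      have hfds : ContDiff ℝ ∞ (fderiv ℝ φ) := hφ.fderiv_right (by simp)
      have e2 : iteratedFDeriv ℝ j (fderiv ℝ R) q = iteratedFDeriv ℝ j (fderiv ℝ φ) (p0 + q) := by
        obtain ⟨l, rfl⟩ : ∃ l, j = l + 1 := ⟨j - 1, by omega⟩
        rw [e1, ← iteratedFDeriv_comp_add_left]
        have := iteratedFDeriv_sub_apply (𝕜 := ℝ) (i := l + 1) (x := q) (f := fun q => fderiv ℝ φ (p0 + q)) (g := fun _ => fderiv ℝ φ p0)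
          ((hfds.comp (contDiff_const.add contDiff_id)).of_le (by exact_mod_cast le_top)).contDiffAt contDiffAt_const
        rw [iteratedFDeriv_succ_const, Pi.zero_apply, sub_zero] at this
        exact this
      rw [e2, norm_iteratedFDeriv_fderiv]
      exact (hφB _ h _).trans (hBD _ (by omega))
  have hE : ContDiff ℝ ∞ (fun q => Complex.exp (Complex.I * (R q : ℝ))) := hee.comp hRs
  have haq : ContDiff ℝ ∞ (fun q => a (p0 + q)) := ha.comp (contDiff_const.add contDiff_id)
  refine ⟨(hE.mul haq).mul hG, ?_, ?_⟩
  · exact (closure_mono (Function.support_mul_subset_right _ _)).trans hGs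
  intro n hn q
  by_cases hq : q ∈ tsupport G
  · have hq1 := hGs hq
    refine iter_mul_bound N _ G (hE.mul haq) hG q _ _ ?_ (fun n hn => hGB n hn q) n hn
    refine iter_mul_bound N _ _ hE haq q _ _ ?_ ?_
    · intro n hn
      refine (norm_iteratedFDeriv_comp_le hee hRs (n := n) (by exact_mod_cast le_top) q (C := 1) (D := D) (fun i _ => hee_b i _)
        (fun i h1 h2 => hRb q hq1 i h1 (h2.trans hn))).trans ?_
      have := Nat.factorial_le hn
      gcongr
    · intro n hn
      rw [iteratedFDeriv_comp_add_left]
      exact (haB n hn _).trans (hBD _ (by omega))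
  · have h0 : iteratedFDeriv ℝ n (fun q => Complex.exp (Complex.I * (R q : ℝ)) * a (p0 + q) * G q) q = 0 := by
      by_contra hne
      have := support_iteratedFDeriv_subset n hne
      exact hq (closure_mono (Function.support_mul_subset_right _ _) this)
    rw [h0, norm_zero]
    have : 0 ≤ BG := (norm_nonneg _).trans (hGB 0 (Nat.zero_le _) 0)
    positivity
end

section
variable {E : Type*} [NormedAddCommGroup E] [InnerProductSpace ℝ E] [FiniteDimensional ℝ E]
variable {P : Type*} [NormedAddCommGroup P] [NormedSpace ℝ P]

/-- partial gradient along the embedding `i`. -/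
noncomputable def pgrad (i : E →L[ℝ] P) (φ : P → ℝ) (p : P) : E :=
  (InnerProductSpace.toDual ℝ E).symm ((fderiv ℝ φ p).comp i)

lemma inner_pgrad (i : E →L[ℝ] P) (φ : P → ℝ) (p : P) (u : E) :
    inner ℝ u (pgrad i φ p) = fderiv ℝ φ p (i u) := by
  rw [real_inner_comm, pgrad, InnerProductSpace.toDual_symm_apply]; rfl

lemma continuous_pgrad (i : E →L[ℝ] P) (φ : P → ℝ) (hφ : ContDiff ℝ ∞ φ) : Continuous (pgrad i φ) := by
  have : Continuous (fderiv ℝ φ) := hφ.continuous_fderiv (by simp)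
  unfold pgrad
  exact (InnerProductSpace.toDual ℝ E).symm.continuous.comp (this.clm_comp continuous_const)

lemma geom (φ : P → ℝ) (hφ : ContDiff ℝ ∞ φ) (B3 c : ℝ) (h3 : ∀ p, ‖iteratedFDeriv ℝ 3 φ p‖ ≤ B3)
    (hc0 : 0 < c) (i j : E →L[ℝ] P) (hi : ‖i‖ ≤ 1) (hj : ‖j‖ ≤ 1)
    (hc : ∀ p v, c * ‖v‖ ≤ ‖(fderiv ℝ (fderiv ℝ φ) p (j v)).comp i‖) (p0 : P) :
    (∀ ξ, ∃ z, pgrad i φ (p0 + j z) = ξ) ∧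
      ∀ y y', c / 2 * ‖y - y'‖ ≤ ‖pgrad i φ (p0 + j y) - pgrad i φ (p0 + j y')‖ := by
  have hD1 : ContDiff ℝ ∞ (fderiv ℝ φ) := hφ.fderiv_right (by simp)
  have hD2 : ContDiff ℝ ∞ (fderiv ℝ (fderiv ℝ φ)) := hD1.fderiv_right (by simp)
  have hB3 : 0 ≤ B3 := (norm_nonneg _).trans (h3 0)
  have hlip : ∀ p q, ‖fderiv ℝ (fderiv ℝ φ) q - fderiv ℝ (fderiv ℝ φ) p‖ ≤ B3 * ‖q - p‖ := by
    intro p q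
    refine Convex.norm_image_sub_le_of_norm_fderiv_le (𝕜 := ℝ) (s := Set.univ) (f := fderiv ℝ (fderiv ℝ φ)) (C := B3) (x := p) (y := q) ?_ ?_ ?_ ?_ ?_
    · intro x _
      exact (hD2.differentiable (by simp)).differentiableAt
    · intro x _
      have := h3 x
      rwa [show 3 = 1 + 1 + 1 from rfl, ← norm_iteratedFDeriv_fderiv, ← norm_iteratedFDeriv_fderiv, norm_iteratedFDeriv_one] at this
    · exact convex_univ
    · trivial
    · trivial
  have htay : ∀ p q, ‖fderiv ℝ φ (p + q) - fderiv ℝ φ p - fderiv ℝ (fderiv ℝ φ) p q‖ ≤ B3 * ‖q‖ ^ 2 := by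
    intro p q
    have := Convex.norm_image_sub_le_of_norm_fderiv_le' (𝕜 := ℝ) (s := Metric.closedBall p ‖q‖)
      (f := fderiv ℝ φ) (φ := fderiv ℝ (fderiv ℝ φ) p) (C := B3 * ‖q‖) (x := p) (y := p + q)
      (fun x _ => (hD1.differentiable (by simp)).differentiableAt)
      (fun x hx => (hlip p x).trans (by
        rw [mem_closedBall_iff_norm] at hx; gcongr))
      (convex_closedBall _ _) (by simp) (by simp)
    rw [add_sub_cancel_left] at this
    exact this.trans_eq (by ring)
  let pre : (P →L[ℝ] ℝ) →L[ℝ] (E →L[ℝ] ℝ) := (ContinuousLinearMap.compL ℝ E P ℝ).flip i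
  let td : (E →L[ℝ] ℝ) →L[ℝ] E := 
    { toFun := (InnerProductSpace.toDual ℝ E).symm
      map_add' := fun x y => map_add _ x y
      map_smul' := by intro r T; simp
      cont := (InnerProductSpace.toDual ℝ E).symm.continuous }
  have htd : ∀ T, ‖td T‖ = ‖T‖ := fun T => (InnerProductSpace.toDual ℝ E).symm.norm_map T
  have hpg : ∀ p, pgrad i φ p = td (pre (fderiv ℝ φ p)) := fun p => rfl
  have hpre : ∀ T, ‖pre T‖ ≤ ‖T‖ := fun T => by
    have : ‖T.comp i‖ ≤ ‖T‖ * ‖i‖ := T.opNorm_comp_le i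
    refine this.trans ?_
    nlinarith [norm_nonneg T]
  refine newton (fun y => pgrad i φ (p0 + j y))
    (fun y => td.comp (pre.comp ((fderiv ℝ (fderiv ℝ φ) (p0 + j y)).comp j)))
    ((continuous_pgrad i φ hφ).comp (by fun_prop)) ?_ (B3 + 1) c (by linarith) hc0 ?_ ?_
  · have := hD2.continuous.comp (g := fderiv ℝ (fderiv ℝ φ)) (f := fun y => p0 + j y) (by fun_prop)
    exact continuous_const.clm_comp (continuous_const.clm_comp (this.clm_comp continuous_const))
  · intro y v
    have e : pgrad i φ (p0 + j (y + v)) - pgrad i φ (p0 + j y) - td (pre (fderiv ℝ (fderiv ℝ φ) (p0 + j y) (j v)))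
        = td (pre (fderiv ℝ φ (p0 + j y + j v) - fderiv ℝ φ (p0 + j y) - fderiv ℝ (fderiv ℝ φ) (p0 + j y) (j v))) := by
      rw [hpg, hpg, map_add, map_sub, map_sub, map_sub, map_sub, add_assoc]
    have hjv : ‖j v‖ ≤ ‖v‖ := by
      refine (j.le_opNorm v).trans ?_
      nlinarith [norm_nonneg v]
    change ‖pgrad i φ (p0 + j (y + v)) - pgrad i φ (p0 + j y) - td (pre (fderiv ℝ (fderiv ℝ φ) (p0 + j y) (j v)))‖ ≤ _
    rw [e, htd]
    refine (hpre _).trans ((htay _ _).trans ?_)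
    gcongr
    linarith
  · intro y v
    change _ ≤ ‖td (pre (fderiv ℝ (fderiv ℝ φ) (p0 + j y) (j v)))‖
    rw [htd]
    exact hc _ _

variable [MeasurableSpace E] [BorelSpace E]

lemma kernel_int (s : ℝ) (hs : (Module.finrank ℝ E : ℝ) < s) (c : ℝ) (hc : 0 < c) :
    ∃ C : ENNReal, C ≠ ⊤ ∧ ∀ F : E → E, (∀ ξ, ∃ z, F z = ξ) → (∀ y y', c * ‖y - y'‖ ≤ ‖F y - F y'‖) →
      ∀ ξ, ∫⁻ y, ENNReal.ofReal ((1 + ‖ξ - F y‖) ^ (-s)) ≤ C := by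
  have hs0 : 0 < s := lt_of_le_of_lt (by positivity) hs
  set m := min 1 c with hm
  have hm0 : 0 < m := by positivity
  refine ⟨ENNReal.ofReal (m ^ (-s)) * ∫⁻ y : E, ENNReal.ofReal ((1 + ‖y‖) ^ (-s)), ?_, ?_⟩
  · have := (integrable_one_add_norm (μ := (volume : Measure E)) hs).lintegral_lt_top
    exact ENNReal.mul_ne_top ENNReal.ofReal_ne_top this.ne
  · intro F hF hl ξ
    obtain ⟨z, rfl⟩ := hF ξ
    rw [← lintegral_sub_right_eq_self (fun y : E => ENNReal.ofReal ((1 + ‖y‖) ^ (-s))) z, ← lintegral_const_mul' _ _ ENNReal.ofReal_ne_top]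
    apply lintegral_mono
    intro y
    simp only
    rw [← ENNReal.ofReal_mul (by positivity), ← Real.mul_rpow (by positivity) (by positivity)]
    apply ENNReal.ofReal_le_ofReal
    apply Real.rpow_le_rpow_of_nonpos (by positivity) _ (by linarith)
    have h1 := hl z y
    rw [norm_sub_rev] at h1
    have h2 : m ≤ 1 := min_le_left _ _
    have h3 : m ≤ c := min_le_right _ _
    nlinarith [norm_nonneg (y - z)]
end

lemma op_lower {E : Type*} [NormedAddCommGroup E] [NormedSpace ℝ E] [FiniteDimensional ℝ E] (δ B : ℝ) (hδ : 0 < δ) :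
    ∃ c > 0, ∀ T : E →L[ℝ] E, ‖T‖ ≤ B → δ ≤ |T.det| → ∀ v, c * ‖v‖ ≤ ‖T v‖ := by
  have hK : IsCompact ({T : E →L[ℝ] E | ‖T‖ ≤ B ∧ δ ≤ |T.det|} ×ˢ Metric.sphere (0:E) 1) := by
    refine IsCompact.prod ?_ (isCompact_sphere _ _)
    have : {T : E →L[ℝ] E | ‖T‖ ≤ B ∧ δ ≤ |T.det|} = Metric.closedBall 0 B ∩ {T | δ ≤ |T.det|} := by
      ext T; simp
    rw [this]
    exact (isCompact_closedBall _ _).inter_right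
      (isClosed_le continuous_const ContinuousLinearMap.continuous_det.abs)
  rcases Set.eq_empty_or_nonempty ({T : E →L[ℝ] E | ‖T‖ ≤ B ∧ δ ≤ |T.det|} ×ˢ Metric.sphere (0:E) 1) with h | h
  · refine ⟨1, one_pos, fun T hT hd v => ?_⟩
    by_cases hv : v = 0
    · simp [hv]
    exfalso
    have : (T, ‖v‖⁻¹ • v) ∈ ({T : E →L[ℝ] E | ‖T‖ ≤ B ∧ δ ≤ |T.det|} ×ˢ Metric.sphere (0:E) 1) := by
      refine ⟨⟨hT, hd⟩, ?_⟩
      have : ‖v‖ ≠ 0 := by simpa using hv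
      simp [norm_smul, this]
    rw [h] at this
    exact this
  · obtain ⟨⟨T0, v0⟩, ⟨⟨hT0, hd0⟩, hv0⟩, hmin⟩ := hK.exists_isMinOn h
      (f := fun q : (E →L[ℝ] E) × E => ‖q.1 q.2‖) (by fun_prop)
    simp only at hT0 hd0 hv0
    have hv0' : ‖v0‖ = 1 := by simpa using hv0
    refine ⟨‖T0 v0‖, ?_, ?_⟩
    · rw [gt_iff_lt, norm_pos_iff]
      intro h0
      have hdet : T0.det ≠ 0 := by
        intro h; rw [h, abs_zero] at hd0; linarith
      have hu : IsUnit (LinearMap.det (T0 : E →ₗ[ℝ] E)) := isUnit_iff_ne_zero.2 hdet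
      have hinj : Function.Injective (T0 : E →ₗ[ℝ] E) := by
        have := (LinearMap.isUnit_iff_isUnit_det _).2 hu
        exact ((Module.End.isUnit_iff _).1 this).1
      have : v0 = 0 := hinj (by simpa using h0)
      rw [this] at hv0'; simp at hv0'
    · intro T hT hd v
      by_cases hv : v = 0
      · simp [hv]
      have hv' : ‖v‖ ≠ 0 := by simpa using hv
      have hmem : (T, ‖v‖⁻¹ • v) ∈ ({T : E →L[ℝ] E | ‖T‖ ≤ B ∧ δ ≤ |T.det|} ×ˢ Metric.sphere (0:E) 1) := by
        refine ⟨⟨hT, hd⟩, ?_⟩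
        simp [norm_smul, hv']
      have := hmin hmem
      simp only [Set.mem_ofPred_eq, map_smul, norm_smul, norm_inv, norm_norm] at this
      rw [inv_mul_eq_div, le_div_iff₀ (by positivity)] at this
      exact this

lemma nondeg (d : ℕ) (δ B2 : ℝ) (hδ : 0 < δ) : ∃ c > 0,
    ∀ φ : EuclideanSpace ℝ (Fin d) × EuclideanSpace ℝ (Fin d) → ℝ, ContDiff ℝ ∞ φ →
      (∀ p, ‖iteratedFDeriv ℝ 2 φ p‖ ≤ B2) →
      (∀ x y : EuclideanSpace ℝ (Fin d), δ ≤ |(mixedHessian φ x y).det|) →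
      (∀ p v, c * ‖v‖ ≤ ‖(fderiv ℝ (fderiv ℝ φ) p (ContinuousLinearMap.inr ℝ _ _ v)).comp
        (ContinuousLinearMap.inl ℝ (EuclideanSpace ℝ (Fin d)) (EuclideanSpace ℝ (Fin d)))‖) ∧
      (∀ p v, c * ‖v‖ ≤ ‖(fderiv ℝ (fderiv ℝ φ) p (ContinuousLinearMap.inl ℝ _ _ v)).comp
        (ContinuousLinearMap.inr ℝ (EuclideanSpace ℝ (Fin d)) (EuclideanSpace ℝ (Fin d)))‖) := by
  obtain ⟨c, hc0, hc⟩ := op_lower (E := EuclideanSpace ℝ (Fin d)) δ B2 hδ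
  refine ⟨c, hc0, fun φ hφ h2 hdet => ?_⟩
  have hD1 : ContDiff ℝ ∞ (fderiv ℝ φ) := hφ.fderiv_right (by simp)
  set inl := ContinuousLinearMap.inl ℝ (EuclideanSpace ℝ (Fin d)) (EuclideanSpace ℝ (Fin d)) with hinl
  set inr := ContinuousLinearMap.inr ℝ (EuclideanSpace ℝ (Fin d)) (EuclideanSpace ℝ (Fin d)) with hinr
  have hinl1 : ∀ v, ‖inl v‖ = ‖v‖ := fun v => by simp [hinl]
  have hinr1 : ∀ v, ‖inr v‖ = ‖v‖ := fun v => by simp [hinr]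
  have hD2 : ∀ p, ‖fderiv ℝ (fderiv ℝ φ) p‖ ≤ B2 := fun p => by
    have := h2 p
    rwa [show 2 = 1 + 1 from rfl, ← norm_iteratedFDeriv_fderiv, norm_iteratedFDeriv_one] at this
  let td : (EuclideanSpace ℝ (Fin d) →L[ℝ] ℝ) →L[ℝ] EuclideanSpace ℝ (Fin d) :=
    { toFun := (InnerProductSpace.toDual ℝ (EuclideanSpace ℝ (Fin d))).symm
      map_add' := fun x y => map_add _ x y
      map_smul' := by intro r T; simp
      cont := (InnerProductSpace.toDual ℝ (EuclideanSpace ℝ (Fin d))).symm.continuous }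
  have htd : ∀ T, ‖td T‖ = ‖T‖ := fun T => (InnerProductSpace.toDual ℝ (EuclideanSpace ℝ (Fin d))).symm.norm_map T
  let pre : (EuclideanSpace ℝ (Fin d) × EuclideanSpace ℝ (Fin d) →L[ℝ] ℝ) →L[ℝ] (EuclideanSpace ℝ (Fin d) →L[ℝ] ℝ) :=
    (ContinuousLinearMap.compL ℝ (EuclideanSpace ℝ (Fin d)) _ ℝ).flip inl
  let T : EuclideanSpace ℝ (Fin d) × EuclideanSpace ℝ (Fin d) → EuclideanSpace ℝ (Fin d) →L[ℝ] EuclideanSpace ℝ (Fin d) :=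
    fun p => td.comp (pre.comp ((fderiv ℝ (fderiv ℝ φ) p).comp inr))
  have hTn : ∀ p v, ‖T p v‖ = ‖(fderiv ℝ (fderiv ℝ φ) p (inr v)).comp inl‖ := fun p v => htd _
  have hTin : ∀ p v w, inner ℝ (T p v) w = fderiv ℝ (fderiv ℝ φ) p (inr v) (inl w) := fun p v w => by
    have := InnerProductSpace.toDual_symm_apply (𝕜 := ℝ) (x := w) (y := (fderiv ℝ (fderiv ℝ φ) p (inr v)).comp inl)
    exact this
  have hTB : ∀ p, ‖T p‖ ≤ B2 := fun p => by
    have hB : 0 ≤ B2 := (norm_nonneg _).trans (h2 p)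
    refine ContinuousLinearMap.opNorm_le_bound _ hB fun v => ?_
    rw [hTn]
    refine ContinuousLinearMap.opNorm_le_bound _ (by positivity) fun w => ?_
    calc _ ≤ ‖fderiv ℝ (fderiv ℝ φ) p‖ * ‖inr v‖ * ‖inl w‖ := ContinuousLinearMap.le_opNorm₂ _ _ _
      _ ≤ _ := by rw [hinl1, hinr1]; gcongr; exact hD2 p
  have hTd : ∀ p, (T p).det = (mixedHessian φ p.1 p.2).det := fun p => by
    change LinearMap.det (T p : EuclideanSpace ℝ (Fin d) →ₗ[ℝ] EuclideanSpace ℝ (Fin d)) = _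
    rw [← LinearMap.det_toMatrix (EuclideanSpace.basisFun (Fin d) ℝ).toBasis]
    congr 1
    ext i j
    rw [LinearMap.toMatrix_apply, OrthonormalBasis.coe_toBasis_repr_apply, OrthonormalBasis.repr_apply_apply,
      real_inner_comm]
    simp only [OrthonormalBasis.coe_toBasis, ContinuousLinearMap.coe_coe, EuclideanSpace.basisFun_apply]
    rw [hTin]
    simp only [mixedHessian, Matrix.of_apply]
    rw [fderiv_clm_apply (hD1.differentiable (by simp)).differentiableAt (by fun_prop)]
    simp [hinl, hinr]
  have hlow : ∀ p v, c * ‖v‖ ≤ ‖T p v‖ := fun p => hc (T p) (hTB p) (by rw [hTd]; exact hdet _ _)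
  refine ⟨fun p v => by rw [← hTn]; exact hlow p v, fun p v => ?_⟩
  have hinj : Function.Injective (T p : EuclideanSpace ℝ (Fin d) →ₗ[ℝ] EuclideanSpace ℝ (Fin d)) := by
    rw [injective_iff_map_eq_zero]
    intro w hw
    have h := hlow p w
    have hw' : T p w = 0 := hw
    rw [hw', norm_zero] at h
    have : ‖w‖ ≤ 0 := by nlinarith
    simpa using this
  obtain ⟨w, hw⟩ := (LinearMap.injective_iff_surjective.1 hinj) v
  have hw : T p w = v := hw
  have h1 := hlow p w
  rw [hw] at h1
  have hsym : fderiv ℝ (fderiv ℝ φ) p (inr w) (inl v) = fderiv ℝ (fderiv ℝ φ) p (inl v) (inr w) := by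
    have := (hφ.contDiffAt (x := p)).isSymmSndFDerivAt (by rw [minSmoothness_of_isRCLikeNormedField]; exact WithTop.coe_le_coe.2 le_top)
    exact this _ _
  have h3 : ‖v‖ ^ 2 = fderiv ℝ (fderiv ℝ φ) p (inl v) (inr w) := by
    rw [← hsym, ← hTin, hw, real_inner_self_eq_norm_sq]
  have h4 := ((fderiv ℝ (fderiv ℝ φ) p (inl v)).comp inr).le_opNorm w
  rw [ContinuousLinearMap.comp_apply, ← h3, Real.norm_of_nonneg (by positivity)] at h4
  rcases eq_or_ne v 0 with rfl | hv
  · simp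
  · have hv' : 0 < ‖v‖ := by simpa using hv
    set M := ‖(fderiv ℝ (fderiv ℝ φ) p (inl v)).comp inr‖
    have hM : 0 ≤ M := norm_nonneg _
    have : c * ‖v‖ ^ 2 ≤ M * ‖v‖ := by nlinarith [norm_nonneg w]
    nlinarith

section
variable {E : Type*} [NormedAddCommGroup E] [InnerProductSpace ℝ E] [FiniteDimensional ℝ E]
    [MeasurableSpace E] [BorelSpace E]

lemma win_supp (g : E → ℝ) (hgs : HasCompactSupport g) (x0 : E) (u : E → ℂ) :
    HasCompactSupport (fun x => (g (x - x0) : ℂ) * u x) := by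
  have h1 : HasCompactSupport (fun x => g (x - x0)) := by
    have := hgs.comp_homeomorph (Homeomorph.subRight x0)
    exact this
  have h2 : HasCompactSupport (fun x => (g (x - x0) : ℂ)) := h1.comp_left (g := fun t : ℝ => (t : ℂ)) (by simp)
  exact h2.mul_right

lemma win_iso (g : E → ℝ) (hg : Continuous g) (hgs : HasCompactSupport g) (u : E → ℂ) (hu : Continuous u) :
    ∫⁻ x0, ∫⁻ ξ, ‖𝓕 (fun x => (g (x - x0) : ℂ) * u x) ξ‖ₑ ^ 2 = (∫⁻ x, ‖g x‖ₑ ^ 2) * ∫⁻ x, ‖u x‖ₑ ^ 2 := by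
  have : ∀ x0, ∫⁻ ξ, ‖𝓕 (fun x => (g (x - x0) : ℂ) * u x) ξ‖ₑ ^ 2 = ∫⁻ x, ‖g (x - x0)‖ₑ ^ 2 * ‖u x‖ₑ ^ 2 := by
    intro x0
    rw [planch _ (by fun_prop) (win_supp g hgs x0 u)]
    congr 1; ext x
    rw [enorm_mul, mul_pow]
    congr 2
    rw [← ofReal_norm, ← ofReal_norm, Complex.norm_real]
  simp_rw [this]
  rw [lintegral_lintegral_swap]
  · have : ∀ x, ∫⁻ x0, ‖g (x - x0)‖ₑ ^ 2 * ‖u x‖ₑ ^ 2 = (∫⁻ x, ‖g x‖ₑ ^ 2) * ‖u x‖ₑ ^ 2 := by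
      intro x
      rw [lintegral_mul_const'' _ (by fun_prop)]
      rw [lintegral_sub_left_eq_self (fun y => ‖g y‖ₑ ^ 2) x]
    simp_rw [this]
    rw [lintegral_const_mul'' _ (by fun_prop)]
  · unfold Function.uncurry
    have : Continuous (fun p : E × E => ‖g (p.2 - p.1)‖ₑ) := by fun_prop
    have h2 : Continuous (fun p : E × E => ‖u p.2‖ₑ) := by fun_prop
    exact ((this.measurable.pow_const 2).mul (h2.measurable.pow_const 2)).aemeasurable

lemma win_cont (g : E → ℝ) (hg : Continuous g) (f : E → ℂ) (hf : Continuous f) (hfs : HasCompactSupport f) :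
    Continuous (fun z : E × E => 𝓕 (fun y => (g (y - z.1) : ℂ) * f y) z.2) := by
  simp_rw [Real.fourier_eq']
  rw [← continuousOn_univ]
  refine continuousOn_integral_of_compact_support (k := tsupport f) hfs ?_ ?_
  · apply Continuous.continuousOn
    unfold Function.uncurry
    fun_prop
  · intro z y _ hy
    simp [image_eq_zero_of_notMem_tsupport hy]

lemma pair_bound (k F : E → ℂ) (hk : Continuous k) (hki : Integrable k) (hF : Integrable F)
    (hk' : Integrable (𝓕⁻ k)) : ‖∫ y, k y * F y‖ₑ ≤ ∫⁻ η, ‖𝓕⁻ k η‖ₑ * ‖𝓕 F η‖ₑ := by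
  have hk2 : Integrable (𝓕 k) := by
    have := hk'.comp_neg
    refine this.congr (Filter.Eventually.of_forall fun x => ?_)
    simp [Real.fourierInv_eq_fourier_neg]
  have h1 : 𝓕 (𝓕⁻ k) = k := hk.fourier_fourierInv_eq hki hk2
  have h2 := fourier_flip (𝓕⁻ k) F hk' hF
  rw [h1] at h2
  rw [h2]
  refine (enorm_integral_le_lintegral_enorm _).trans ?_
  simp_rw [enorm_mul]; exact le_rfl

end

section
variable {E : Type*} [NormedAddCommGroup E] [InnerProductSpace ℝ E] [FiniteDimensional ℝ E]
    [MeasurableSpace E] [BorelSpace E]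

/-- Partial windowed transform of the kernel `M` in the first variable. -/
noncomputable def kap (g : E → ℝ) (M : E × E → ℂ) (x0 ξ y : E) : ℂ :=
  ∫ x, Complex.exp (((-2 * Real.pi * inner ℝ x ξ : ℝ) : ℂ) * Complex.I) * ((g (x - x0) : ℂ) * M (x, y))

lemma win_zero (g : E → ℝ) (hgb : ∀ x, 1 < ‖x‖ → g x = 0) (x0 x : E) (hx : x ∉ Metric.closedBall x0 1) :
    g (x - x0) = 0 := by
  apply hgb
  rw [mem_closedBall_iff_norm] at hx
  linarith

lemma kap_cont (g : E → ℝ) (hg : Continuous g) (hgb : ∀ x, 1 < ‖x‖ → g x = 0) (M : E × E → ℂ) (hM : Continuous M)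
    (x0 ξ : E) : Continuous (kap g M x0 ξ) := by
  unfold kap
  rw [← continuousOn_univ]
  refine continuousOn_integral_of_compact_support (k := Metric.closedBall x0 1) (isCompact_closedBall _ _) ?_ ?_
  · apply Continuous.continuousOn
    unfold Function.uncurry
    fun_prop
  · intro z y _ hy
    simp [win_zero g hgb x0 y hy]

lemma win_rep (g : E → ℝ) (hg : Continuous g) (hgb : ∀ x, 1 < ‖x‖ → g x = 0) (M : E × E → ℂ) (hM : Continuous M)
    (f : E → ℂ) (hf : Continuous f) (hfs : HasCompactSupport f) (x0 ξ : E) :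
    ((∫ x, g x ^ 2 : ℝ) : ℂ) * 𝓕 (fun x => (g (x - x0) : ℂ) * ∫ y, M (x, y) * f y) ξ
      = ∫ y0, ∫ y, ((g (y - y0) : ℂ) * kap g M x0 ξ y) * ((g (y - y0) : ℂ) * f y) := by
  have hkc := kap_cont g hg hgb M hM x0 ξ
  have e1 : 𝓕 (fun x => (g (x - x0) : ℂ) * ∫ y, M (x, y) * f y) ξ = ∫ y, kap g M x0 ξ y * f y := by
    rw [Real.fourier_eq']
    have : ∀ x, Complex.exp (((-2 * Real.pi * inner ℝ x ξ : ℝ) : ℂ) * Complex.I) • ((g (x - x0) : ℂ) * ∫ y, M (x, y) * f y)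
      = ∫ y, Complex.exp (((-2 * Real.pi * inner ℝ x ξ : ℝ) : ℂ) * Complex.I) * ((g (x - x0) : ℂ) * M (x, y)) * f y := by
      intro x
      rw [smul_eq_mul, ← mul_assoc, ← integral_const_mul]
      congr 1; ext y; ring
    simp_rw [this]
    rw [integral_integral_swap_of_hasCompactSupport]
    · congr 1; ext y
      rw [integral_mul_const]; rfl
    · unfold Function.uncurry
      fun_prop
    · refine HasCompactSupport.intro ((isCompact_closedBall x0 1).prod hfs) ?_
      rintro ⟨x, y⟩ hxy
      rw [Set.mem_prod, not_and_or] at hxy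
      rcases hxy with h | h
      · simp [Function.uncurry, win_zero g hgb x0 x h]
      · simp [Function.uncurry, image_eq_zero_of_notMem_tsupport h]
  rw [e1, integral_integral_swap_of_hasCompactSupport]
  · rw [← integral_const_mul]
    congr 1; ext y
    have : ∀ y0, ((g (y - y0) : ℂ) * kap g M x0 ξ y) * ((g (y - y0) : ℂ) * f y)
        = ((g (y - y0) ^ 2 : ℝ) : ℂ) * (kap g M x0 ξ y * f y) := by
      intro y0; push_cast; ring
    simp_rw [this]
    rw [integral_mul_const, integral_complex_ofReal, integral_sub_left_eq_self (fun x => g x ^ 2) volume y]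
  · unfold Function.uncurry
    fun_prop
  · refine HasCompactSupport.intro ((hfs.isCompact.cthickening (r := 1)).prod hfs.isCompact) ?_
    rintro ⟨y0, y⟩ hxy
    rw [Set.mem_prod, not_and_or] at hxy
    by_cases hy : y ∈ tsupport f
    · rcases hxy with h | h
      · have : g (y - y0) = 0 := by
          apply hgb
          by_contra h1
          apply h
          apply Metric.mem_cthickening_of_dist_le _ y _ _ hy
          rw [dist_eq_norm, norm_sub_rev]; linarith
        simp [Function.uncurry, this]
      · exact absurd hy h
    · simp [Function.uncurry, image_eq_zero_of_notMem_tsupport hy]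

lemma kap_inv (g : E → ℝ) (hg : Continuous g) (hgb : ∀ x, 1 < ‖x‖ → g x = 0) (φ : E × E → ℝ) (hφ : Continuous φ)
    (a : E × E → ℂ) (ha : Continuous a) (x0 y0 ξ η : E) :
    ‖𝓕⁻ (fun y => (g (y - y0) : ℂ) * kap g (fun p => Complex.exp (Complex.I * φ p) * a p) x0 ξ y) η‖
     = ‖∫ q : E × E, Complex.exp (-(2 * Real.pi * Complex.I *
        (inner ℝ q.1 (ξ - (1 / (2 * Real.pi)) • pgrad (ContinuousLinearMap.inl ℝ E E) φ (x0, y0)) +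
          inner ℝ q.2 (-η - (1 / (2 * Real.pi)) • pgrad (ContinuousLinearMap.inr ℝ E E) φ (x0, y0)) : ℝ))) *
        (Complex.exp (Complex.I * (φ ((x0, y0) + q) - φ (x0, y0) - fderiv ℝ φ (x0, y0) q : ℝ)) * a ((x0, y0) + q)
          * ((g q.1 * g q.2 : ℝ) : ℂ))‖ := by
  have : (volume : Measure (E × E)).IsAddLeftInvariant := by
    rw [Measure.volume_eq_prod]; infer_instance
  set Φ : E × E → ℂ := fun p => Complex.exp (((2 * Real.pi * inner ℝ p.2 η : ℝ) : ℂ) * Complex.I) *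
    ((g (p.2 - y0) : ℂ) * (Complex.exp (((-2 * Real.pi * inner ℝ p.1 ξ : ℝ) : ℂ) * Complex.I) *
      ((g (p.1 - x0) : ℂ) * (Complex.exp (Complex.I * φ p) * a p)))) with hΦ
  have hΦc : Continuous Φ := by rw [hΦ]; fun_prop
  have hΦs : HasCompactSupport Φ := by
    refine HasCompactSupport.intro ((isCompact_closedBall x0 1).prod (isCompact_closedBall y0 1)) ?_
    rintro ⟨x, y⟩ hxy
    rw [Set.mem_prod, not_and_or] at hxy
    rcases hxy with h | h
    · simp [hΦ, win_zero g hgb x0 x h]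
    · simp [hΦ, win_zero g hgb y0 y h]
  have e1 : 𝓕⁻ (fun y => (g (y - y0) : ℂ) * kap g (fun p => Complex.exp (Complex.I * φ p) * a p) x0 ξ y) η
      = ∫ q, Φ ((x0, y0) + q) := by
    rw [integral_add_left_eq_self, Measure.volume_eq_prod, integral_prod_symm]
    · rw [Real.fourierInv_eq']
      congr 1; ext y
      rw [hΦ]
      simp only
      rw [integral_const_mul, integral_const_mul]; rfl
    · rw [← Measure.volume_eq_prod]
      have : IsFiniteMeasureOnCompacts (volume : Measure (E × E)) := by
        rw [Measure.volume_eq_prod]; infer_instance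
      exact hΦc.integrable_of_hasCompactSupport hΦs
  rw [e1]
  set A : ℂ := Complex.exp (((2 * Real.pi * inner ℝ y0 η + -2 * Real.pi * inner ℝ x0 ξ + φ (x0, y0) : ℝ) : ℂ) * Complex.I)
  have hA : ‖A‖ = 1 := Complex.norm_exp_ofReal_mul_I _
  have hone : ∀ z : ℂ, ‖z‖ = ‖A * z‖ := fun z => by rw [norm_mul, hA, one_mul]
  conv_rhs => rw [hone, ← integral_const_mul]
  congr 2; ext q
  obtain ⟨u, v⟩ := q
  have hD : fderiv ℝ φ (x0, y0) (u, v) = inner ℝ u (pgrad (ContinuousLinearMap.inl ℝ E E) φ (x0, y0))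
      + inner ℝ v (pgrad (ContinuousLinearMap.inr ℝ E E) φ (x0, y0)) := by
    rw [inner_pgrad, inner_pgrad, ← map_add]; simp
  have hpi : (Real.pi : ℂ) ≠ 0 := by exact_mod_cast Real.pi_ne_zero
  simp only [hΦ, Prod.mk_add_mk, add_sub_cancel_left, A]
  rw [hD]
  have e2 : ∀ a1 a2 a3 b1 b2 b3 g1 g2 aa : ℂ, a1 + a2 + a3 = b1 + b2 + b3 → Complex.exp a1 * (g2 * (Complex.exp a2 * (g1 * (Complex.exp a3 * aa)))) =
     Complex.exp b1 * (Complex.exp b2 * (Complex.exp b3 * aa * (g1 * g2))) := by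
    intro a1 a2 a3 b1 b2 b3 g1 g2 aa h
    have := congrArg Complex.exp h
    simp only [Complex.exp_add] at this
    linear_combination (g1 * g2 * aa) * this
  push_cast
  apply e2
  simp only [inner_add_left, inner_sub_right, inner_neg_right, inner_smul_right]
  push_cast
  field_simp
  ring
end

section
variable {E : Type*} [NormedAddCommGroup E] [InnerProductSpace ℝ E] [FiniteDimensional ℝ E]
    [MeasurableSpace E] [BorelSpace E]

/-- The Schur kernel. -/
noncomputable def KK (s Cf : ℝ) (φ : E × E → ℝ) (w z : E × E) : ENNReal :=
  ENNReal.ofReal (Cf * ((1 + ‖w.2 - (1 / (2 * Real.pi)) • pgrad (ContinuousLinearMap.inl ℝ E E) φ (w.1, z.1)‖) ^ (-s) *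
    (1 + ‖-z.2 - (1 / (2 * Real.pi)) • pgrad (ContinuousLinearMap.inr ℝ E E) φ (w.1, z.1)‖) ^ (-s)))

lemma KK_cont (s Cf : ℝ) (φ : E × E → ℝ) (hφ : ContDiff ℝ ∞ φ) : Continuous (Function.uncurry (KK s Cf φ)) := by
  have h1 := continuous_pgrad (ContinuousLinearMap.inl ℝ E E) φ hφ
  have h2 := continuous_pgrad (ContinuousLinearMap.inr ℝ E E) φ hφ
  unfold Function.uncurry KK
  refine ENNReal.continuous_ofReal.comp (continuous_const.mul (Continuous.mul ?_ ?_))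
  · exact Continuous.rpow_const (by fun_prop) (fun x => Or.inl (by positivity))
  · exact Continuous.rpow_const (by fun_prop) (fun x => Or.inl (by positivity))

lemma KK_int (s : ℝ) (hs : (Module.finrank ℝ E : ℝ) < s) (Cf : ℝ) (hCf : 0 ≤ Cf) (c : ℝ) (hc : 0 < c) :
    ∃ C : ENNReal, C ≠ ⊤ ∧ ∀ φ : E × E → ℝ, ContDiff ℝ ∞ φ →
      (∀ x, (∀ ξ, ∃ z, pgrad (ContinuousLinearMap.inl ℝ E E) φ (x, z) = ξ) ∧
        ∀ y y', c * ‖y - y'‖ ≤ ‖pgrad (ContinuousLinearMap.inl ℝ E E) φ (x, y) - pgrad (ContinuousLinearMap.inl ℝ E E) φ (x, y')‖) →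
      (∀ y, (∀ ξ, ∃ z, pgrad (ContinuousLinearMap.inr ℝ E E) φ (z, y) = ξ) ∧
        ∀ x x', c * ‖x - x'‖ ≤ ‖pgrad (ContinuousLinearMap.inr ℝ E E) φ (x, y) - pgrad (ContinuousLinearMap.inr ℝ E E) φ (x', y)‖) →
      (∀ w, ∫⁻ z, KK s Cf φ w z ≤ C) ∧ (∀ z, ∫⁻ w, KK s Cf φ w z ≤ C) := by
  obtain ⟨A1, hA1, h1⟩ := kernel_int (E := E) s hs 1 one_pos
  obtain ⟨A2, hA2, h2⟩ := kernel_int (E := E) s hs (1 / (2 * Real.pi) * c) (by positivity)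
  have h1' : ∀ ξ : E, ∫⁻ y, ENNReal.ofReal ((1 + ‖ξ - y‖) ^ (-s)) ≤ A1 :=
    h1 id (fun ξ => ⟨ξ, rfl⟩) (by simp)
  have hpi : (0:ℝ) < 1 / (2 * Real.pi) := by positivity
  have hmul : ∀ (v : E) (r : ℝ), ENNReal.ofReal ((1 + ‖v‖) ^ (-s) * r) = ENNReal.ofReal ((1 + ‖v‖) ^ (-s)) * ENNReal.ofReal r :=
    fun v r => ENNReal.ofReal_mul (by positivity)
  have h2' : ∀ F : E → E, (∀ ξ, ∃ z, F z = ξ) → (∀ y y', c * ‖y - y'‖ ≤ ‖F y - F y'‖) →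
      ∀ ξ, ∫⁻ y, ENNReal.ofReal ((1 + ‖ξ - (1 / (2 * Real.pi)) • F y‖) ^ (-s)) ≤ A2 := by
    intro F hF hl
    refine h2 (fun y => (1 / (2 * Real.pi)) • F y) ?_ ?_
    · intro ξ
      obtain ⟨z, hz⟩ := hF ((2 * Real.pi) • ξ)
      refine ⟨z, ?_⟩
      simp only [hz, smul_smul]
      rw [one_div, inv_mul_cancel₀ (by positivity), one_smul]
    · intro y y'
      rw [← smul_sub, norm_smul, Real.norm_of_nonneg hpi.le, mul_assoc]
      gcongr
      exact hl y y'
  refine ⟨ENNReal.ofReal Cf * (A2 * A1), by finiteness, fun φ hφ hg1 hg2 => ⟨fun w => ?_, fun z => ?_⟩⟩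
  · have hm : Measurable (KK s Cf φ w) := ((KK_cont s Cf φ hφ).comp (by fun_prop : Continuous fun z => (w, z))).measurable
    rw [Measure.volume_eq_prod, lintegral_prod _ hm.aemeasurable]
    unfold KK
    simp only [ENNReal.ofReal_mul hCf]
    simp_rw [hmul]
    have : ∀ x : E, ∀ b : E, ∀ t : ENNReal, t ≠ ⊤ → ∫⁻ y : E, ENNReal.ofReal Cf * (t * ENNReal.ofReal ((1 + ‖-y - b‖) ^ (-s)))
        ≤ ENNReal.ofReal Cf * (t * A1) := by
      intro x b t ht
      rw [lintegral_const_mul' _ _ (by finiteness), lintegral_const_mul' _ _ ht]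
      gcongr
      refine le_trans (le_of_eq ?_) (h1' (-b))
      congr 1; ext y; rw [show -y - b = -b - y by abel]
    refine (lintegral_mono fun x => this x _ _ (by finiteness)).trans ?_
    rw [lintegral_const_mul' _ _ (by finiteness), lintegral_mul_const' _ _ (by finiteness)]
    gcongr
    exact h2' _ (hg1 w.1).1 (hg1 w.1).2 _
  · have hm : Measurable (fun w => KK s Cf φ w z) := ((KK_cont s Cf φ hφ).comp (by fun_prop : Continuous fun w => (w, z))).measurable
    rw [Measure.volume_eq_prod, lintegral_prod _ hm.aemeasurable]
    unfold KK
    simp only [ENNReal.ofReal_mul hCf]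
    simp_rw [hmul]
    have : ∀ b : E, ∀ t : ENNReal, t ≠ ⊤ → ∫⁻ y : E, ENNReal.ofReal Cf * (ENNReal.ofReal ((1 + ‖y - b‖) ^ (-s)) * t)
        ≤ ENNReal.ofReal Cf * (A1 * t) := by
      intro b t ht
      rw [lintegral_const_mul' _ _ (by finiteness), lintegral_mul_const' _ _ ht]
      gcongr
      refine le_trans (le_of_eq ?_) (h1' b)
      congr 1; ext y; rw [norm_sub_rev]
    refine (lintegral_mono fun x => this _ _ (by finiteness)).trans ?_
    rw [lintegral_const_mul' _ _ (by finiteness), lintegral_const_mul' _ _ (by finiteness), mul_comm A1]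
    gcongr
    exact h2' _ (hg2 z.1).1 (hg2 z.1).2 _

/-- Data of a window. -/
lemma window_exists (N : ℕ) : ∃ g : E → ℝ, Continuous g ∧ HasCompactSupport g ∧ (∀ x, 1 < ‖x‖ → g x = 0) ∧
    0 < ∫ x, g x ^ 2 ∧ ENNReal.ofReal (∫ x, g x ^ 2) = ∫⁻ x, ‖g x‖ₑ ^ 2 ∧
    ContDiff ℝ ∞ (fun q : E × E => ((g q.1 * g q.2 : ℝ) : ℂ)) ∧
    tsupport (fun q : E × E => ((g q.1 * g q.2 : ℝ) : ℂ)) ⊆ Metric.closedBall 0 1 ∧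
    ∃ BG : ℝ, ∀ n ≤ N, ∀ q, ‖iteratedFDeriv ℝ n (fun q : E × E => ((g q.1 * g q.2 : ℝ) : ℂ)) q‖ ≤ BG := by
  let bmp : ContDiffBump (0:E) := ⟨1/2, 1, by norm_num, by norm_num⟩
  have hgb : ∀ x : E, 1 < ‖x‖ → bmp x = 0 := fun x hx => bmp.zero_of_le_dist (by simpa [bmp] using hx.le)
  have hcd : ContDiff ℝ ∞ bmp := bmp.contDiff
  have hG : ContDiff ℝ ∞ (fun q : E × E => ((bmp q.1 * bmp q.2 : ℝ) : ℂ)) := by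
    refine Complex.ofRealCLM.contDiff.comp ?_
    exact (hcd.comp contDiff_fst).mul (hcd.comp contDiff_snd)
  have hGs : tsupport (fun q : E × E => ((bmp q.1 * bmp q.2 : ℝ) : ℂ)) ⊆ Metric.closedBall 0 1 := by
    refine closure_minimal ?_ Metric.isClosed_closedBall
    intro q hq
    by_contra h
    apply hq
    rw [mem_closedBall_zero_iff, not_le, Prod.norm_def, lt_max_iff] at h
    rcases h with h | h
    · simp [hgb _ h]
    · simp [hgb _ h]
  have hGc : HasCompactSupport (fun q : E × E => ((bmp q.1 * bmp q.2 : ℝ) : ℂ)) :=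
    (isCompact_closedBall 0 1).of_isClosed_subset (isClosed_tsupport _) hGs
  have hsqc : Continuous (fun x => bmp x ^ 2) := bmp.continuous.pow 2
  have hsqs : HasCompactSupport (fun x => bmp x ^ 2) := bmp.hasCompactSupport.comp_left (g := fun t : ℝ => t ^ 2) (by simp)
  refine ⟨bmp, bmp.continuous, bmp.hasCompactSupport, hgb, ?_, ?_, hG, hGs, ?_⟩
  · refine hsqc.integral_pos_of_hasCompactSupport_nonneg_nonzero hsqs (fun x => sq_nonneg _) (x := 0) ?_
    exact pow_ne_zero _ (bmp.pos_of_mem_ball (by simp [bmp])).ne'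
  · rw [ofReal_integral_eq_lintegral_ofReal (hsqc.integrable_of_hasCompactSupport hsqs) (Filter.Eventually.of_forall fun x => sq_nonneg _)]
    congr 1; ext x
    rw [← ofReal_norm, ← ENNReal.ofReal_pow (norm_nonneg _), Real.norm_eq_abs, sq_abs]
  · have : ∀ n : ℕ, ∃ C, ∀ q, ‖iteratedFDeriv ℝ n (fun q : E × E => ((bmp q.1 * bmp q.2 : ℝ) : ℂ)) q‖ ≤ C := fun n =>
      (hG.continuous_iteratedFDeriv (m := n) (by exact_mod_cast le_top)).bounded_above_of_compact_support (hGc.iteratedFDeriv n)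
    choose C hC using this
    refine ⟨∑ n ∈ Finset.range (N + 1), C n, fun n hn q => (hC n q).trans ?_⟩
    exact Finset.single_le_sum (f := C) (fun i _ => (norm_nonneg _).trans (hC i 0)) (Finset.mem_range.2 (by omega))
end

section
variable {E : Type*} [NormedAddCommGroup E] [InnerProductSpace ℝ E] [FiniteDimensional ℝ E]
    [MeasurableSpace E] [BorelSpace E]

lemma win_cont2 (g : E → ℝ) (hg : Continuous g) (hgs : HasCompactSupport g) (u : E → ℂ) (hu : Continuous u) :
    Continuous (fun z : E × E => 𝓕 (fun y => (g (y - z.1) : ℂ) * u y) z.2) := by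
  have : (fun z : E × E => 𝓕 (fun y => (g (y - z.1) : ℂ) * u y) z.2) = fun z =>
      ∫ v, Complex.exp (((-2 * Real.pi * Inner.inner ℝ (v + z.1) z.2 : ℝ) : ℂ) * Complex.I) • ((g v : ℂ) * u (v + z.1)) := by
    ext z
    rw [Real.fourier_eq', ← integral_add_right_eq_self _ z.1]
    simp only [add_sub_cancel_right]
  rw [this, ← continuousOn_univ]
  refine continuousOn_integral_of_compact_support (k := tsupport g) hgs ?_ ?_
  · apply Continuous.continuousOn
    unfold Function.uncurry
    fun_prop
  · intro z y _ hy
    simp [image_eq_zero_of_notMem_tsupport hy]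

lemma core (N : ℕ) (hs : (Module.finrank ℝ E : ℝ) < (N:ℝ) / 2) (B : ℕ → ℝ) (c : ℝ) (hc0 : 0 < c) :
    ∃ C : ENNReal, C ≠ ⊤ ∧ ∀ (φ : E × E → ℝ) (a : E × E → ℂ), ContDiff ℝ ∞ φ →
      (∀ k : ℕ, 2 ≤ k → ∀ p, ‖iteratedFDeriv ℝ k φ p‖ ≤ B k) →
      (∀ p v, c * ‖v‖ ≤ ‖(fderiv ℝ (fderiv ℝ φ) p (ContinuousLinearMap.inr ℝ E E v)).comp (ContinuousLinearMap.inl ℝ E E)‖) →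
      (∀ p v, c * ‖v‖ ≤ ‖(fderiv ℝ (fderiv ℝ φ) p (ContinuousLinearMap.inl ℝ E E v)).comp (ContinuousLinearMap.inr ℝ E E)‖) →
      ContDiff ℝ ∞ a → (∀ k : ℕ, k ≤ N → ∀ p, ‖iteratedFDeriv ℝ k a p‖ ≤ B k) →
      ∀ f : E → ℂ, Continuous f → HasCompactSupport f →
        ∫⁻ x, ‖∫ y, Complex.exp (Complex.I * φ (x, y)) * a (x, y) * f y‖ₑ ^ 2 ≤ C * ∫⁻ x, ‖f x‖ₑ ^ 2 := by
  obtain ⟨g, hg, hgs, hgb, hγ, hγe, hG, hGs, BG, hBG⟩ := window_exists (E := E) N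
  set γ := ∫ x, g x ^ 2 with hγdef
  obtain ⟨Cb, hCb⟩ := amp_bound N B _ hG hGs BG hBG
  have hN : 0 < N := by
    rcases Nat.eq_zero_or_pos N with rfl | h
    · exfalso
      have : (0:ℝ) ≤ Module.finrank ℝ E := by positivity
      simp at hs
      linarith
    · exact h
  obtain ⟨Cf, hCf0, hCf⟩ := fdecay (E := E) N hN Cb
  set s := (N:ℝ) / 2 with hsdef
  obtain ⟨CK, hCK, hK⟩ := KK_int (E := E) s hs Cf hCf0 (c / 2) (by positivity)
  set γe := ∫⁻ x, ‖g x‖ₑ ^ 2 with hγedef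
  have hγe0 : γe ≠ 0 := by rw [← hγe]; simpa using hγ
  have hγet : γe ≠ ⊤ := by rw [← hγe]; finiteness
  have hX0 : γe ^ 2 * γe ≠ 0 := by positivity
  have hXt : γe ^ 2 * γe ≠ ⊤ := by finiteness
  refine ⟨(γe ^ 2 * γe)⁻¹ * (CK * CK * γe), by finiteness, ?_⟩
  intro φ a hφ hφB hc1 hc2 ha haB f hf hfs
  have hinl : ‖ContinuousLinearMap.inl ℝ E E‖ ≤ 1 := ContinuousLinearMap.norm_inl_le_one ℝ E E
  have hinr : ‖ContinuousLinearMap.inr ℝ E E‖ ≤ 1 := ContinuousLinearMap.norm_inr_le_one ℝ E E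
  obtain ⟨hK1, hK2⟩ := hK φ hφ (by
      intro x
      have := geom φ hφ (B 3) c (hφB 3 (by norm_num)) hc0 _ _ hinl hinr hc1 (x, 0)
      simpa using this) (by
      intro y
      have := geom φ hφ (B 3) c (hφB 3 (by norm_num)) hc0 _ _ hinr hinl hc2 (0, y)
      simpa using this)
  set M : E × E → ℂ := fun p => Complex.exp (Complex.I * φ p) * a p with hMdef
  have hφc := hφ.continuous
  have hac := ha.continuous
  have hM : Continuous M := by rw [hMdef]; fun_prop
  have hTc : Continuous (fun x => ∫ y, M (x, y) * f y) := by
    rw [← continuousOn_univ]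
    refine continuousOn_integral_of_compact_support (k := tsupport f) hfs ?_ ?_
    · apply Continuous.continuousOn
      unfold Function.uncurry
      fun_prop
    · intro z y _ hy
      simp [image_eq_zero_of_notMem_tsupport hy]
  have hkb : ∀ x0 ξ y0 η, ‖𝓕⁻ (fun y => (g (y - y0) : ℂ) * kap g M x0 ξ y) η‖ ≤
      Cf * ((1 + ‖ξ - (1 / (2 * Real.pi)) • pgrad (ContinuousLinearMap.inl ℝ E E) φ (x0, y0)‖) ^ (-s) *
        (1 + ‖-η - (1 / (2 * Real.pi)) • pgrad (ContinuousLinearMap.inr ℝ E E) φ (x0, y0)‖) ^ (-s)) := by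
    intro x0 ξ y0 η
    rw [hMdef, kap_inv g hg hgb φ hφc a hac]
    obtain ⟨b1, b2, b3⟩ := hCb φ a hφ hφB ha haB (x0, y0)
    exact hCf _ b1 b2 b3 _ _
  set V : E × E → ENNReal := fun z => ‖𝓕 (fun y => (g (y - z.1) : ℂ) * f y) z.2‖ₑ with hVdef
  have hV : Continuous V := (win_cont g hg f hf hfs).enorm
  set W : E × E → ENNReal := fun w => γe * ‖𝓕 (fun x => (g (x - w.1) : ℂ) * ∫ y, M (x, y) * f y) w.2‖ₑ with hWdef
  have hKc := KK_cont s Cf φ hφ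
  have hW : ∀ w, W w ≤ ∫⁻ z, KK s Cf φ w z * V z := by
    rintro ⟨x0, ξ⟩
    have hkc := kap_cont g hg hgb M hM x0 ξ
    have e1 : W (x0, ξ) = ‖∫ y0, ∫ y, ((g (y - y0) : ℂ) * kap g M x0 ξ y) * ((g (y - y0) : ℂ) * f y)‖ₑ := by
      rw [← win_rep g hg hgb M hM f hf hfs x0 ξ, enorm_mul, hWdef]
      congr 1
      rw [← hγe, ← ofReal_norm, Complex.norm_real, Real.norm_of_nonneg hγ.le]
    have hm : Measurable (fun z => KK s Cf φ (x0, ξ) z * V z) :=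
      (hKc.comp (by fun_prop : Continuous fun z => ((x0, ξ), z))).measurable.mul hV.measurable
    rw [e1, Measure.volume_eq_prod, lintegral_prod _ hm.aemeasurable]
    refine (enorm_integral_le_lintegral_enorm _).trans (lintegral_mono fun y0 => ?_)
    have hks := win_supp g hgs y0 (kap g M x0 ξ)
    have hkc' : Continuous (fun y => (g (y - y0) : ℂ) * kap g M x0 ξ y) := by fun_prop
    have hFc : Continuous (fun y => (g (y - y0) : ℂ) * f y) := by fun_prop
    refine (pair_bound _ _ hkc' (hkc'.integrable_of_hasCompactSupport hks)
      (hFc.integrable_of_hasCompactSupport (win_supp g hgs y0 f)) ?_).trans ?_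
    · have hcont : Continuous (𝓕⁻ (fun y => (g (y - y0) : ℂ) * kap g M x0 ξ y)) := by
        have : 𝓕⁻ (fun y => (g (y - y0) : ℂ) * kap g M x0 ξ y) = fun η => 
          ∫ v, Complex.exp ((((2 * Real.pi * Inner.inner ℝ v η : ℝ) : ℂ) * Complex.I)) • ((g (v - y0) : ℂ) * kap g M x0 ξ v) := by
          ext η; rw [Real.fourierInv_eq']
        rw [this, ← continuousOn_univ]
        refine continuousOn_integral_of_compact_support (k := Metric.closedBall y0 1) (isCompact_closedBall _ _) ?_ ?_
        · apply Continuous.continuousOn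
          unfold Function.uncurry
          fun_prop
        · intro z y _ hy
          simp [win_zero g hgb y0 y hy]
      have hi : Integrable (fun η : E => (1 + ‖-η - (1 / (2 * Real.pi)) • pgrad (ContinuousLinearMap.inr ℝ E E) φ (x0, y0)‖) ^ (-s)) := by
        have h0 := integrable_one_add_norm (μ := (volume : Measure E)) hs
        have h1 := (h0.comp_sub_right ((1 / (2 * Real.pi)) • pgrad (ContinuousLinearMap.inr ℝ E E) φ (x0, y0))).comp_neg
        exact h1
      refine Integrable.mono' ((hi.const_mul _).const_mul Cf) hcont.aestronglyMeasurable
        (Filter.Eventually.of_forall fun η => hkb x0 ξ y0 η)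
    · refine lintegral_mono fun η => ?_
      refine mul_le_mul_left ?_ _
      rw [← ofReal_norm]
      exact ENNReal.ofReal_le_ofReal (hkb x0 ξ y0 η)
  have hsch := schur_test (volume : Measure (E × E)) (volume : Measure (E × E)) (KK s Cf φ) hKc.measurable V hV.measurable W hW CK CK hK1 hK2
  have eV : ∫⁻ z, V z ^ 2 = γe * ∫⁻ x, ‖f x‖ₑ ^ 2 := by
    rw [Measure.volume_eq_prod, lintegral_prod _ (hV.measurable.pow_const 2).aemeasurable]
    exact win_iso g hg hgs f hf
  have eW : γe ^ 2 * γe * ∫⁻ x, ‖∫ y, M (x, y) * f y‖ₑ ^ 2 ≤ ∫⁻ w, W w ^ 2 := by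
    have hc := (win_cont2 g hg hgs _ hTc).enorm
    have hm : Measurable (fun w => W w ^ 2) := (hc.measurable.const_mul γe).pow_const 2
    rw [mul_assoc, ← win_iso g hg hgs _ hTc, Measure.volume_eq_prod, lintegral_prod _ hm.aemeasurable, hWdef]
    simp only [mul_pow]
    simp_rw [lintegral_const_mul' (γe ^ 2) _ (ENNReal.pow_ne_top hγet)]
    exact le_rfl
  rw [eV] at hsch
  have hfin := eW.trans hsch
  rw [ENNReal.mul_le_iff_le_inv hX0 hXt] at hfin
  refine hfin.trans (le_of_eq ?_)
  ring
end

end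

lemma lint_scale {E : Type*} [NormedAddCommGroup E] [InnerProductSpace ℝ E] [FiniteDimensional ℝ E]
    [MeasurableSpace E] [BorelSpace E] (G : E → ENNReal) (s : ℝ) (hs : 0 < s) :
    ∫⁻ x, G (s⁻¹ • x) = ENNReal.ofReal (s ^ Module.finrank ℝ E) * ∫⁻ x, G x := by
  have h := Measure.map_addHaar_smul (volume : Measure E) (inv_ne_zero hs.ne')
  have he : MeasurableEmbedding (fun x : E => s⁻¹ • x) := measurableEmbedding_const_smul₀ (inv_ne_zero hs.ne')
  rw [← he.lintegral_map, h, lintegral_smul_measure, smul_eq_mul]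
  congr 2
  rw [inv_pow, inv_inv, abs_of_nonneg (by positivity)]

lemma phase_scale {P : Type*} [NormedAddCommGroup P] [NormedSpace ℝ P] (φ : P → ℝ) (hφ : ContDiff ℝ ∞ φ)
    (s : ℝ) (hs : 1 ≤ s) :
    ContDiff ℝ ∞ (fun p => s ^ 2 * φ (s⁻¹ • p)) ∧
    (∀ k : ℕ, 2 ≤ k → ∀ p, ‖iteratedFDeriv ℝ k (fun p => s ^ 2 * φ (s⁻¹ • p)) p‖ ≤ ‖iteratedFDeriv ℝ k φ (s⁻¹ • p)‖) ∧
    ∀ p, fderiv ℝ (fderiv ℝ (fun p => s ^ 2 * φ (s⁻¹ • p))) p = fderiv ℝ (fderiv ℝ φ) (s⁻¹ • p) := by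
  have hs0 : 0 < s := by linarith
  have hc : ContDiff ℝ ∞ (fun p => φ (s⁻¹ • p)) := hφ.comp (contDiff_const_smul _)
  refine ⟨contDiff_const.mul hc, fun k hk p => ?_, fun p => ?_⟩
  · have hkφ : ContDiff ℝ k φ := hφ.of_le (by exact_mod_cast le_top)
    have hkc : ContDiff ℝ k (fun p => φ (s⁻¹ • p)) := hc.of_le (by exact_mod_cast le_top)
    have e := iteratedFDeriv_const_smul_apply' (a := s ^ 2) (hkc.contDiffAt (x := p))
    simp only [smul_eq_mul] at e
    rw [e, iteratedFDeriv_comp_const_smul _ hkφ]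
    simp only
    rw [norm_smul, norm_smul, ← mul_assoc]
    refine mul_le_of_le_one_left (norm_nonneg _) ?_
    rw [← norm_mul, Real.norm_of_nonneg (by positivity), inv_pow, ← div_eq_mul_inv, div_le_one (by positivity)]
    exact pow_le_pow_right₀ hs hk
  · have hD1 : ContDiff ℝ ∞ (fderiv ℝ φ) := hφ.fderiv_right (by simp)
    have e1 : fderiv ℝ (fun p => s ^ 2 * φ (s⁻¹ • p)) = fun p => s • fderiv ℝ φ (s⁻¹ • p) := by
      ext1 p
      have := fderiv_const_smul ((hc.differentiable (by simp)).differentiableAt (x := p)) (s ^ 2)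
      have e : (s ^ 2 • fun p => φ (s⁻¹ • p)) = fun p => s ^ 2 * φ (s⁻¹ • p) := rfl
      rw [e, fderiv_comp_smul] at this
      rw [this, smul_smul]
      congr 1
      field_simp
    rw [e1]
    have hc1 : ContDiff ℝ ∞ (fun p => fderiv ℝ φ (s⁻¹ • p)) := hD1.comp (contDiff_const_smul _)
    have := fderiv_const_smul ((hc1.differentiable (by simp)).differentiableAt (x := p)) s
    have e : (s • fun p => fderiv ℝ φ (s⁻¹ • p)) = fun p => s • fderiv ℝ φ (s⁻¹ • p) := rfl
    rw [e, fderiv_comp_smul] at this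
    rw [this, smul_smul, mul_inv_cancel₀ hs0.ne', one_smul]

lemma amp_scale {P : Type*} [NormedAddCommGroup P] [NormedSpace ℝ P] (a : P → ℂ) (ha : ContDiff ℝ ∞ a)
    (s : ℝ) (hs : 1 ≤ s) :
    ContDiff ℝ ∞ (fun p => a (s⁻¹ • p)) ∧
    ∀ k : ℕ, ∀ p, ‖iteratedFDeriv ℝ k (fun p => a (s⁻¹ • p)) p‖ ≤ ‖iteratedFDeriv ℝ k a (s⁻¹ • p)‖ := by
  have hs0 : 0 < s := by linarith
  refine ⟨ha.comp (contDiff_const_smul _), fun k p => ?_⟩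
  have hk : ContDiff ℝ k a := ha.of_le (by exact_mod_cast le_top)
  rw [iteratedFDeriv_comp_const_smul _ hk]
  simp only
  rw [norm_smul]
  refine mul_le_of_le_one_left (norm_nonneg _) ?_
  rw [Real.norm_of_nonneg (by positivity)]
  exact pow_le_one₀ (by positivity) (inv_le_one_of_one_le₀ hs)

/-- Fujiwara's L² boundedness theorem for oscillatory integral operators with
nondegenerate phase. -/
theorem stmt13 (d : ℕ) (hd : 1 ≤ d) (δ : ℝ) (hδ : 0 < δ) (B : ℕ → ℝ) :
    ∃ C > 0,
      ∀ (φ : EuclideanSpace ℝ (Fin d) × EuclideanSpace ℝ (Fin d) → ℝ)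
        (a : EuclideanSpace ℝ (Fin d) × EuclideanSpace ℝ (Fin d) → ℂ),
        ContDiff ℝ ∞ φ →
        (∀ k : ℕ, 2 ≤ k → ∀ p, ‖iteratedFDeriv ℝ k φ p‖ ≤ B k) →
        (∀ x y : EuclideanSpace ℝ (Fin d), δ ≤ |(mixedHessian φ x y).det|) →
        ContDiff ℝ ∞ a →
        (∀ k : ℕ, k ≤ 2 * d + 1 → ∀ p, ‖iteratedFDeriv ℝ k a p‖ ≤ B k) →
        ∀ lam : ℝ, 1 ≤ lam →
        ∀ f : EuclideanSpace ℝ (Fin d) → ℂ, Continuous f → HasCompactSupport f →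
          eLpNorm
            (fun x : EuclideanSpace ℝ (Fin d) =>
              ((lam / (2 * Real.pi)) ^ ((d : ℝ) / 2) : ℝ) •
                ∫ y : EuclideanSpace ℝ (Fin d),
                  Complex.exp (Complex.I * lam * φ (x, y)) * a (x, y) * f y)
            2 volume
          ≤ ENNReal.ofReal C * eLpNorm f 2 volume := by
  obtain ⟨c, hc0, hc⟩ := nondeg d δ (B 2) hδ
  have hfr : Module.finrank ℝ (EuclideanSpace ℝ (Fin d)) = d := by simp
  obtain ⟨C, hCt, hC⟩ := core (E := EuclideanSpace ℝ (Fin d)) (2 * d + 1) (by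
    rw [hfr]; push_cast; linarith) B c hc0
  have hCt' : C ^ (1/2 : ℝ) ≠ ⊤ := ENNReal.rpow_ne_top_of_nonneg (by norm_num) hCt
  refine ⟨(C ^ (1/2 : ℝ)).toReal + 1, by positivity, ?_⟩
  intro φ a hφ hφB hdet ha haB lam hlam f hf hfs
  set s := Real.sqrt lam with hsdef
  have hs1 : 1 ≤ s := Real.one_le_sqrt.2 hlam
  have hs0 : 0 < s := by linarith
  have hs2 : s ^ 2 = lam := Real.sq_sqrt (by linarith)
  obtain ⟨hn1, hn2⟩ := hc φ hφ (hφB 2 le_rfl) hdet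
  obtain ⟨p1, p2, p3⟩ := phase_scale φ hφ s hs1
  obtain ⟨a1, a2⟩ := amp_scale a ha s hs1
  have hsm : Continuous (fun y : EuclideanSpace ℝ (Fin d) => s⁻¹ • y) := by fun_prop
  have key := hC _ _ p1 (fun k hk p => (p2 k hk p).trans (hφB k hk _))
    (fun p v => by rw [p3]; exact hn1 _ v) (fun p v => by rw [p3]; exact hn2 _ v)
    a1 (fun k hk p => (a2 k p).trans (haB k hk _)) (fun y => f (s⁻¹ • y)) (hf.comp hsm)
    (hfs.comp_homeomorph (Homeomorph.smulOfNeZero s⁻¹ (inv_ne_zero hs0.ne')))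
  set L : EuclideanSpace ℝ (Fin d) → ℂ := fun x => ∫ y : EuclideanSpace ℝ (Fin d),
    Complex.exp (Complex.I * lam * φ (x, y)) * a (x, y) * f y with hL
  have e1 : ∀ x : EuclideanSpace ℝ (Fin d), ∫ y : EuclideanSpace ℝ (Fin d),
      Complex.exp (Complex.I * ((s ^ 2 * φ (s⁻¹ • (x, y)) : ℝ) : ℂ)) * a (s⁻¹ • (x, y)) * f (s⁻¹ • y)
      = (s ^ d) • L (s⁻¹ • x) := by
    intro x
    have := Measure.integral_comp_inv_smul_of_nonneg (volume : Measure (EuclideanSpace ℝ (Fin d)))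
      (fun y => Complex.exp (Complex.I * lam * φ (s⁻¹ • x, y)) * a (s⁻¹ • x, y) * f y) hs0.le
    rw [hfr] at this
    rw [hL, ← this]
    congr 1; ext y
    rw [hs2, Prod.smul_mk]
    push_cast
    rw [mul_assoc Complex.I]
  simp_rw [e1] at key
  set r := ENNReal.ofReal (s ^ d) with hr
  have hr0 : r ≠ 0 := by rw [hr]; simpa using by positivity
  have hrt : r ≠ ⊤ := by finiteness
  have e2 := lint_scale (fun x => ‖(s ^ d) • L x‖ₑ ^ 2) s hs0
  have e3 := lint_scale (fun x => ‖f x‖ₑ ^ 2) s hs0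
  rw [hfr] at e2 e3
  rw [e2, e3, mul_left_comm, ENNReal.mul_le_mul_iff_right hr0 hrt] at key
  have hnorm : ∀ h : EuclideanSpace ℝ (Fin d) → ℂ, eLpNorm h 2 volume = (∫⁻ x, ‖h x‖ₑ ^ 2) ^ (1/2 : ℝ) := by
    intro h
    rw [eLpNorm_eq_lintegral_rpow_enorm_toReal (by norm_num) (by norm_num)]
    simp
  have hκ : (lam / (2 * Real.pi)) ^ ((d : ℝ) / 2) ≤ s ^ d := by
    have h1 : s ^ d = lam ^ ((d:ℝ) / 2) := by
      rw [hsdef, Real.sqrt_eq_rpow, ← Real.rpow_natCast, ← Real.rpow_mul (by linarith)]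
      congr 1; ring
    rw [h1]
    apply Real.rpow_le_rpow (by positivity) _ (by positivity)
    apply div_le_self (by linarith)
    nlinarith [Real.pi_gt_three]
  rw [hnorm, hnorm]
  calc _ ≤ (∫⁻ x, ‖(s ^ d) • L x‖ₑ ^ 2) ^ (1/2 : ℝ) := by
        gcongr with x
        rw [enorm_smul, enorm_smul]
        gcongr
        rw [← ofReal_norm, ← ofReal_norm, Real.norm_of_nonneg (by positivity), Real.norm_of_nonneg (by positivity)]
        exact ENNReal.ofReal_le_ofReal hκ
    _ ≤ (C * ∫⁻ x, ‖f x‖ₑ ^ 2) ^ (1/2 : ℝ) := by gcongr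
    _ = C ^ (1/2 : ℝ) * (∫⁻ x, ‖f x‖ₑ ^ 2) ^ (1/2 : ℝ) := ENNReal.mul_rpow_of_nonneg _ _ (by norm_num)
    _ ≤ _ := by
        gcongr
        rw [ENNReal.le_ofReal_iff_toReal_le hCt' (by positivity)]
        linarith
end
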